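/- arXiv:1809.03417 — 8 statements merged into one kernel-verified Lean document; each statement's English description precedes it below -/
import Mathlib

section
/- Let Γ be a Neumaier graph with parameters (v, k, λ; m, s). Then s is the largest real root of the quadratic polynomial (v − 2k + λ)·y² + (k² + 3k − λ − v(λ + 2))·y + v(λ + 1 − k); that is, s is a root of this polynomial and every real root y of it satisfies y ≤ s. -/
/-- `G` is edge-regular with parameters `(v, k, lam)`: it has `v` vertices, at least one
edge, is `k`-regular, and every pair of adjacent vertices has exactly `lam` common
neighbours. -/
def IsEdgeRegular {V : Type*} [Fintype V] (G : SimpleGraph V) (v k lam : ℕ) : Prop :=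
  Fintype.card V = v ∧ G ≠ ⊥ ∧ (∀ u : V, (G.neighborSet u).ncard = k) ∧
    ∀ u w : V, G.Adj u w → (G.commonNeighbors u w).ncard = lam

/-- The clique `S` in `G` is `m`-regular (with `m > 0`): every vertex of `G` not in `S`
is adjacent to exactly `m` vertices of `S`. -/
def IsRegularClique {V : Type*} (G : SimpleGraph V) (S : Finset V) (m : ℕ) : Prop :=
  0 < m ∧ ∀ u : V, u ∉ S → (G.neighborSet u ∩ ↑S).ncard = m

/-- `G` is a Neumaier graph with parameters `(v, k, lam; m, s)`: a non-complete
edge-regular graph with parameters `(v, k, lam)` containing an `m`-regular `s`-clique,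
where `s ≥ 2`. -/
def IsNeumaier {V : Type*} [Fintype V] (G : SimpleGraph V) (v k lam m s : ℕ) : Prop :=
  IsEdgeRegular G v k lam ∧ G ≠ ⊤ ∧ 2 ≤ s ∧
    ∃ S : Finset V, G.IsClique ↑S ∧ S.card = s ∧ IsRegularClique G S m

open Finset in
/-- Double counting of the edges leaving a regular clique. -/
theorem IsRegularClique.card_mul_eq {V : Type*} [Fintype V] {G : SimpleGraph V} {S : Finset V}
    {m k : ℕ} (hS : IsRegularClique G S m) (hc : G.IsClique ↑S)
    (hk : ∀ u : V, (G.neighborSet u).ncard = k) :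
    (#S : ℝ) * (k - #S + 1) = (Fintype.card V - #S) * m := by
  classical
  have hout : ∀ a ∈ S, (#(Sᶜ.bipartiteAbove G.Adj a) : ℝ) = k - #S + 1 := by
    intro a ha
    have hin : G.neighborSet a = ↑(Sᶜ.bipartiteAbove G.Adj a ∪ S.erase a) := by
      ext u
      have := @hc a ha u
      have := @SimpleGraph.irrefl _ G a
      by_cases hu : u ∈ S <;> by_cases hau : u = a <;>
        simp_all [Finset.bipartiteAbove, eq_comm]
    have hd : Disjoint (Sᶜ.bipartiteAbove G.Adj a) (S.erase a) :=
      disjoint_left.2 fun u hu hu' ↦ by simp_all [Finset.bipartiteAbove]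
    have h := hk a
    rw [hin, Set.ncard_coe_finset, card_union_of_disjoint hd] at h
    have := card_erase_add_one ha
    rw [← h, ← this]
    push_cast
    ring
  have hbelow : ∀ u ∈ Sᶜ, (#(S.bipartiteBelow G.Adj u) : ℝ) = m := by
    intro u hu
    rw [← hS.2 u (mem_compl.1 hu), ← Set.ncard_coe_finset]
    congr 2
    ext a
    simp [Finset.bipartiteBelow, G.adj_comm, and_comm]
  have h := sum_card_bipartiteAbove_eq_sum_card_bipartiteBelow (s := S) (t := Sᶜ) G.Adj
  have h' : (∑ a ∈ S, (#(Sᶜ.bipartiteAbove G.Adj a) : ℝ)) =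
      ∑ u ∈ Sᶜ, (#(S.bipartiteBelow G.Adj u) : ℝ) := mod_cast h
  rw [sum_congr rfl hout, sum_congr rfl hbelow, sum_const, sum_const, nsmul_eq_mul,
    nsmul_eq_mul, card_compl, Nat.cast_sub (card_le_univ S)] at h'
  exact h'

open Finset in
/-- Double counting of the triangles with exactly two vertices in a regular clique. -/
theorem IsRegularClique.card_mul_card_sub_one_mul_eq {V : Type*} [Fintype V]
    {G : SimpleGraph V} {S : Finset V} {m lam : ℕ} (hS : IsRegularClique G S m)
    (hc : G.IsClique ↑S)
    (hl : ∀ u w : V, G.Adj u w → (G.commonNeighbors u w).ncard = lam) :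
    (#S : ℝ) * (#S - 1) * (lam - #S + 2) = (Fintype.card V - #S) * (m * (m - 1)) := by
  classical
  let r : V × V → V → Prop := fun p u ↦ G.Adj p.1 u ∧ G.Adj p.2 u
  have hoff : ∀ T : Finset V, (#T.offDiag : ℝ) = #T * (#T - 1) := by
    intro T
    rw [offDiag_card, Nat.cast_sub (Nat.le_mul_self _)]
    push_cast
    ring
  have hout : ∀ p ∈ S.offDiag, (#(Sᶜ.bipartiteAbove r p) : ℝ) = lam - #S + 2 := by
    rintro ⟨a, b⟩ hp
    obtain ⟨ha, hb, hab⟩ := mem_offDiag.1 hp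
    have hin : G.commonNeighbors a b =
        ↑(Sᶜ.bipartiteAbove r (a, b) ∪ (S.erase a).erase b) := by
      ext u
      have := @hc a ha u
      have := @hc b hb u
      have := @SimpleGraph.irrefl _ G a
      have := @SimpleGraph.irrefl _ G b
      by_cases hu : u ∈ S <;> by_cases hau : u = a <;> by_cases hbu : u = b <;>
        simp_all [Finset.bipartiteAbove, SimpleGraph.mem_commonNeighbors, eq_comm, r]
    have hd : Disjoint (Sᶜ.bipartiteAbove r (a, b)) ((S.erase a).erase b) :=
      disjoint_left.2 fun u hu hu' ↦ by simp_all [Finset.bipartiteAbove]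
    have h := hl a b (hc ha hb hab)
    rw [hin, Set.ncard_coe_finset, card_union_of_disjoint hd] at h
    have h₁ := card_erase_add_one ha
    have h₂ := card_erase_add_one (mem_erase.2 ⟨hab.symm, hb⟩)
    rw [← h, ← h₁, ← h₂]
    push_cast
    ring
  have hbelow : ∀ u ∈ Sᶜ, (#(S.offDiag.bipartiteBelow r u) : ℝ) = m * (m - 1) := by
    intro u hu
    have hm : #{a ∈ S | G.Adj a u} = m := by
      rw [← hS.2 u (mem_compl.1 hu), ← Set.ncard_coe_finset]
      congr 1
      ext a
      simp [G.adj_comm, and_comm]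
    rw [← hm, ← hoff]
    congr 2
    ext ⟨a, b⟩
    simp only [Finset.bipartiteBelow, mem_filter, mem_offDiag, r]
    tauto
  have h := sum_card_bipartiteAbove_eq_sum_card_bipartiteBelow (s := S.offDiag) (t := Sᶜ) r
  have h' : (∑ p ∈ S.offDiag, (#(Sᶜ.bipartiteAbove r p) : ℝ)) =
      ∑ u ∈ Sᶜ, (#(S.offDiag.bipartiteBelow r u) : ℝ) := mod_cast h
  rw [sum_congr rfl hout, sum_congr rfl hbelow, sum_const, sum_const, nsmul_eq_mul,
    nsmul_eq_mul, card_compl, Nat.cast_sub (card_le_univ S), hoff] at h'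
  exact h'

/-- Adjacent vertices together have `2k - lam ≤ v` neighbours. -/
theorem IsEdgeRegular.two_mul_le {V : Type*} [Fintype V] {G : SimpleGraph V} {v k lam : ℕ}
    (h : IsEdgeRegular G v k lam) : 2 * k ≤ v + lam := by
  obtain ⟨hv, hne, hk, hl⟩ := h
  obtain ⟨u, w, huw⟩ := SimpleGraph.ne_bot_iff_exists_adj.1 hne
  have hcard := Set.ncard_union_add_ncard_inter (G.neighborSet u) (G.neighborSet w)
  have hle := Set.ncard_le_card (G.neighborSet u ∪ G.neighborSet w)
  have hcommon := hl u w huw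
  rw [SimpleGraph.commonNeighbors] at hcommon
  rw [Nat.card_eq_fintype_card, hv] at hle
  rw [hcommon, hk, hk] at hcard
  omega

theorem IsEdgeRegular.lam_lt {V : Type*} [Fintype V] {G : SimpleGraph V} {v k lam : ℕ}
    (h : IsEdgeRegular G v k lam) : lam < k := by
  obtain ⟨-, hne, hk, hl⟩ := h
  obtain ⟨u, w, huw⟩ := SimpleGraph.ne_bot_iff_exists_adj.1 hne
  rw [← hl u w huw, ← hk u]
  refine Set.ncard_lt_ncard (Set.ssubset_iff_of_subset Set.inter_subset_left |>.2
    ⟨w, huw, fun hw ↦ G.irrefl hw.2⟩)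

theorem IsEdgeRegular.eq_top {V : Type*} [Fintype V] {G : SimpleGraph V} {v k lam : ℕ}
    (h : IsEdgeRegular G v k lam) (hv : v ≤ k + 1) : G = ⊤ := by
  obtain ⟨rfl, -, hk, -⟩ := h
  ext u w
  refine ⟨fun huw ↦ huw.ne, fun huw ↦ ?_⟩
  have hsub : insert u (G.neighborSet u) = Set.univ := by
    refine (Set.eq_univ_iff_ncard _).2 (le_antisymm (Set.ncard_le_card _) ?_)
    rwa [Set.ncard_insert_of_notMem (G.notMem_neighborSet_self (a := u)), hk, Nat.card_eq_fintype_card]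
  have hw : w ∈ insert u (G.neighborSet u) := hsub ▸ Set.mem_univ w
  exact hw.resolve_left huw.symm

/-- If `Γ` is a Neumaier graph with parameters `(v, k, λ; m, s)`, then `s` is the
largest real root of the polynomial
`(v − 2k + λ)·y² + (k² + 3k − λ − v(λ + 2))·y + v(λ + 1 − k)`. -/
theorem neumaier_s_largest_root {V : Type*} [Fintype V] (G : SimpleGraph V)
    (v k lam m s : ℕ) (h : IsNeumaier G v k lam m s) :
    (((v : ℝ) - 2 * k + lam) * (s : ℝ) ^ 2 +
        ((k : ℝ) ^ 2 + 3 * k - lam - v * (lam + 2)) * (s : ℝ) +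
        (v : ℝ) * (lam + 1 - k) = 0) ∧
      ∀ y : ℝ,
        ((v : ℝ) - 2 * k + lam) * y ^ 2 +
            ((k : ℝ) ^ 2 + 3 * k - lam - v * (lam + 2)) * y +
            (v : ℝ) * (lam + 1 - k) = 0 → y ≤ (s : ℝ) := by
  obtain ⟨hreg, htop, hs, S, hc, rfl, hS⟩ := h
  have hA : (2 * k : ℝ) ≤ v + lam := mod_cast hreg.two_mul_le
  have hlk : (lam + 1 : ℝ) ≤ k := mod_cast hreg.lam_lt
  have hs' : (2 : ℝ) ≤ S.card := mod_cast hs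
  have edges := hS.card_mul_eq hc hreg.2.2.1
  have triangles := hS.card_mul_card_sub_one_mul_eq hc hreg.2.2.2
  rw [hreg.1] at edges triangles
  generalize (S.card : ℝ) = s at *
  have hs0 : s ≠ 0 := by linarith
  have hroot : ((v : ℝ) - 2 * k + lam) * s ^ 2 +
      ((k : ℝ) ^ 2 + 3 * k - lam - v * (lam + 2)) * s + (v : ℝ) * (lam + 1 - k) = 0 := by
    refine (mul_eq_zero.1 ?_).resolve_left hs0
    linear_combination (s * (k - s + 1) - (v - s) + (v - s) * m) * edges - (v - s) * triangles
  refine ⟨hroot, fun y hy ↦ ?_⟩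
  by_contra! hlt
  have hsum : ((v : ℝ) - 2 * k + lam) * (y + s) +
      ((k : ℝ) ^ 2 + 3 * k - lam - v * (lam + 2)) = 0 := by
    refine (mul_eq_zero.1 ?_).resolve_left (sub_ne_zero.2 hlt.ne')
    linear_combination hy - hroot
  have hprod : ((v : ℝ) - 2 * k + lam) * (y * s) = v * (lam + 1 - k) := by
    linear_combination s * hsum - hroot
  have hys : 0 < y * s := mul_pos (by linarith) (by linarith)
  have hC : (v : ℝ) * (lam + 1 - k) ≤ 0 :=
    mul_nonpos_of_nonneg_of_nonpos v.cast_nonneg (by linarith)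
  have hA0 : (v : ℝ) - 2 * k + lam = 0 := by
    refine le_antisymm (nonpos_of_mul_nonpos_left (hprod.trans_le hC) hys) (by linarith)
  have hvk : (v : ℝ) ≤ k + 1 := by
    rw [hA0, zero_mul] at hprod
    rcases mul_eq_zero.1 hprod.symm with h0 | h0 <;> linarith [(k.cast_nonneg : (0 : ℝ) ≤ k)]
  exact htop (hreg.eq_top (mod_cast hvk))
end

section
/- Let Γ be a Neumaier graph with parameters (v, k, λ; m, s). Then m is the largest real root of the quadratic polynomial (v − s)·x² − (v − s)·x − s(s − 1)(λ − s + 2); that is, m is a root of this polynomial and every real root x of it satisfies x ≤ m. -/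
open Classical in
/-- A vertex of degree `m` into `S` sees `m * m - m` ordered pairs of distinct vertices of `S`. -/
theorem card_offDiag_filter_adj {V : Type*} (G : SimpleGraph V) (S : Finset V) (u : V) (m : ℕ)
    (h : (G.neighborSet u ∩ ↑S).ncard = m) :
    (S.offDiag.filter fun p => G.Adj u p.1 ∧ G.Adj u p.2).card = m * m - m := by
  have hcard : (S.filter fun a => G.Adj u a).card = m := by
    rw [← h, ← Set.ncard_coe_finset]
    congr 1
    ext a
    simp [and_comm]
  rw [← hcard, ← Finset.offDiag_card]
  congr 1
  ext p
  simp only [Finset.mem_filter, Finset.mem_offDiag]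
  tauto

open Classical in
/-- The common neighbours of two vertices of a clique `S` are the remaining vertices of `S`
together with the common neighbours outside `S`. -/
theorem card_compl_filter_adj_add {V : Type*} [Fintype V] (G : SimpleGraph V) (S : Finset V)
    (hS : G.IsClique ↑S) {a b : V} (ha : a ∈ S) (hb : b ∈ S) (hab : a ≠ b) :
    (Sᶜ.filter fun u => G.Adj u a ∧ G.Adj u b).card + S.card =
      (G.commonNeighbors a b).ncard + 2 := by
  have hunion : G.commonNeighbors a b =
      ↑((Sᶜ.filter fun u => G.Adj u a ∧ G.Adj u b) ∪ (S \ {a, b})) := by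
    ext u
    simp only [SimpleGraph.mem_commonNeighbors, Finset.coe_union, Set.mem_union, Finset.mem_coe,
      Finset.mem_filter, Finset.mem_compl, Finset.mem_sdiff, Finset.mem_insert,
      Finset.mem_singleton, not_or]
    constructor
    · rintro ⟨h1, h2⟩
      by_cases hu : u ∈ S
      · exact Or.inr ⟨hu, h1.ne', h2.ne'⟩
      · exact Or.inl ⟨hu, h1.symm, h2.symm⟩
    · rintro (⟨-, h1, h2⟩ | ⟨hu, h1, h2⟩)
      · exact ⟨h1.symm, h2.symm⟩
      · exact ⟨hS ha hu (Ne.symm h1), hS hb hu (Ne.symm h2)⟩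
  have hdisj : Disjoint (Sᶜ.filter fun u => G.Adj u a ∧ G.Adj u b) (S \ {a, b}) :=
    Finset.disjoint_left.2 fun u h1 h2 =>
      Finset.mem_compl.1 (Finset.mem_filter.1 h1).1 (Finset.mem_sdiff.1 h2).1
  have hsub : ({a, b} : Finset V) ⊆ S := by
    simp [Finset.insert_subset_iff, ha, hb]
  have hsdiff := Finset.card_sdiff_add_card_eq_card hsub
  rw [Finset.card_pair hab] at hsdiff
  rw [hunion, Set.ncard_coe_finset, Finset.card_union_of_disjoint hdisj]
  omega

open Classical in
/-- Double counting of the ordered pairs of distinct vertices of a regular clique together with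
a common neighbour outside the clique. -/
theorem regularClique_double_count {V : Type*} [Fintype V] (G : SimpleGraph V) (S : Finset V)
    (lam m : ℕ) (hlam : ∀ u w : V, G.Adj u w → (G.commonNeighbors u w).ncard = lam)
    (hS : G.IsClique ↑S) (hm : ∀ u : V, u ∉ S → (G.neighborSet u ∩ ↑S).ncard = m) :
    ((Fintype.card V : ℝ) - S.card) * ((m : ℝ) * m - m) =
      ((S.card : ℝ) * S.card - S.card) * ((lam : ℝ) - S.card + 2) := by
  have hcount := Finset.sum_card_bipartiteAbove_eq_sum_card_bipartiteBelow
    (s := Sᶜ) (t := S.offDiag) fun u p => G.Adj u p.1 ∧ G.Adj u p.2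
  simp only [Finset.bipartiteAbove, Finset.bipartiteBelow] at hcount
  have hreal := congrArg (Nat.cast : ℕ → ℝ) hcount
  push_cast at hreal
  have hleft : ∀ u ∈ Sᶜ,
      ((S.offDiag.filter fun p => G.Adj u p.1 ∧ G.Adj u p.2).card : ℝ) = (m : ℝ) * m - m := by
    intro u hu
    rw [card_offDiag_filter_adj G S u m (hm u (Finset.mem_compl.1 hu)),
      Nat.cast_sub (Nat.le_mul_self m), Nat.cast_mul]
  have hright : ∀ p ∈ S.offDiag,
      ((Sᶜ.filter fun u => G.Adj u p.1 ∧ G.Adj u p.2).card : ℝ) = (lam : ℝ) - S.card + 2 := by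
    intro p hp
    obtain ⟨ha, hb, hab⟩ := Finset.mem_offDiag.1 hp
    have h := card_compl_filter_adj_add G S hS ha hb hab
    rw [hlam _ _ (hS ha hb hab)] at h
    have h' := congrArg (Nat.cast : ℕ → ℝ) h
    push_cast at h'
    linarith
  rw [Finset.sum_congr rfl hleft, Finset.sum_congr rfl hright, Finset.sum_const,
    Finset.sum_const, nsmul_eq_mul, nsmul_eq_mul, Finset.card_compl, Finset.offDiag_card,
    Nat.cast_sub (Finset.card_le_univ S), Nat.cast_sub (Nat.le_mul_self _), Nat.cast_mul] at hreal
  exact hreal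

/-- A clique in a non-complete graph does not contain all the vertices. -/
theorem SimpleGraph.IsClique.card_lt_of_ne_top {V : Type*} [Fintype V] {G : SimpleGraph V}
    {S : Finset V} (hS : G.IsClique ↑S) (hG : G ≠ ⊤) : S.card < Fintype.card V := by
  rw [Finset.card_lt_iff_ne_univ]
  rintro rfl
  refine hG (SimpleGraph.ext ?_)
  ext a b
  exact ⟨fun h => h.ne, fun h => hS (by simp) (by simp) h⟩


/-- If `Γ` is a Neumaier graph with parameters `(v, k, λ; m, s)`, then `m` is the
largest real root of the polynomial `(v − s)·x² − (v − s)·x − s(s − 1)(λ − s + 2)`. -/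
theorem neumaier_m_largest_root {V : Type*} [Fintype V] (G : SimpleGraph V)
    (v k lam m s : ℕ) (h : IsNeumaier G v k lam m s) :
    (((v : ℝ) - s) * (m : ℝ) ^ 2 - ((v : ℝ) - s) * (m : ℝ) -
        (s : ℝ) * ((s : ℝ) - 1) * ((lam : ℝ) - s + 2) = 0) ∧
      ∀ x : ℝ,
        ((v : ℝ) - s) * x ^ 2 - ((v : ℝ) - s) * x -
            (s : ℝ) * ((s : ℝ) - 1) * ((lam : ℝ) - s + 2) = 0 → x ≤ (m : ℝ) := by
  obtain ⟨⟨rfl, -, -, hlam⟩, hG, -, S, hS, rfl, hpos, hm⟩ := h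
  have hcount := regularClique_double_count G S lam m hlam hS hm
  have hlt : (0 : ℝ) < (Fintype.card V : ℝ) - S.card :=
    sub_pos.2 (Nat.cast_lt.2 (hS.card_lt_of_ne_top hG))
  have hm1 : (1 : ℝ) ≤ m := Nat.one_le_cast.2 hpos
  refine ⟨by linear_combination hcount, fun x hx => ?_⟩
  have hprod : ((Fintype.card V : ℝ) - S.card) * ((x - m) * (x + m - 1)) = 0 := by
    linear_combination hx - hcount
  rcases mul_eq_zero.1 ((mul_eq_zero.1 hprod).resolve_left hlt.ne') with h | h <;> linarith
end

section
/- Let Γ be an edge-regular graph with parameters (v, k, λ) such that v = 2k − λ + 1. Then Γ is strongly regular. -/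
/-- `G` is strongly regular with parameters `(v, k, lam, mu)`: it has `v` vertices, is
neither empty nor complete, is `k`-regular, every pair of adjacent vertices has exactly
`lam` common neighbours and every pair of distinct non-adjacent vertices has exactly
`mu` common neighbours. -/
def IsStronglyRegular {V : Type*} [Fintype V] (G : SimpleGraph V) (v k lam mu : ℕ) : Prop :=
  Fintype.card V = v ∧ G ≠ ⊥ ∧ G ≠ ⊤ ∧ (∀ u : V, (G.neighborSet u).ncard = k) ∧
    (∀ u w : V, G.Adj u w → (G.commonNeighbors u w).ncard = lam) ∧
    ∀ u w : V, u ≠ w → ¬ G.Adj u w → (G.commonNeighbors u w).ncard = mu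

namespace SimpleGraph

variable {V : Type*}

/-- Any two distinct non-adjacent vertices have exactly one common neighbour. -/
def UniqueCommonNeighbor (H : SimpleGraph V) : Prop :=
  ∀ x y, x ≠ y → ¬ H.Adj x y → ∃! z, H.Adj x z ∧ H.Adj y z

/-- The neighbours of `x` that are neither equal nor adjacent to its neighbour `z` are counted by
the degree of `x` and the number of common neighbours of `x` and `z`. -/
theorem ncard_neighborSet_eq_add [Finite V] (H : SimpleGraph V) {x z : V} (hxz : H.Adj x z) :
    (H.neighborSet x).ncard =
      {u | H.Adj x u ∧ u ≠ z ∧ ¬ H.Adj z u}.ncard + (H.commonNeighbors x z).ncard + 1 := by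
  have hz : z ∉ {u | H.Adj x u ∧ u ≠ z ∧ ¬ H.Adj z u} ∪ H.commonNeighbors x z := by
    simp [mem_commonNeighbors]
  have hdisj : Disjoint {u | H.Adj x u ∧ u ≠ z ∧ ¬ H.Adj z u} (H.commonNeighbors x z) := by
    rw [Set.disjoint_left]
    rintro u ⟨-, -, hu⟩ hu'
    exact hu hu'.2
  rw [← Set.ncard_union_eq hdisj, ← Set.ncard_insert_of_notMem hz]
  congr 1
  ext u
  simp only [mem_neighborSet, Set.mem_insert_iff, Set.mem_union, Set.mem_ofPred_eq,
    mem_commonNeighbors]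
  by_cases huz : u = z
  · simp [huz, hxz]
  · tauto

namespace UniqueCommonNeighbor

variable {H : SimpleGraph V}

theorem eq_of_adj (hH : H.UniqueCommonNeighbor) {x y z w : V} (hxy : x ≠ y) (h : ¬ H.Adj x y)
    (hxz : H.Adj x z) (hyz : H.Adj y z) (hxw : H.Adj x w) (hyw : H.Adj y w) : z = w :=
  (hH x y hxy h).unique ⟨hxz, hyz⟩ ⟨hxw, hyw⟩

theorem ncard_le_of_not_adj [Finite V] (hH : H.UniqueCommonNeighbor) {x y z : V} (hxy : x ≠ y)
    (h : ¬ H.Adj x y) (hxz : H.Adj x z) (hyz : H.Adj y z) :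
    {u | H.Adj x u ∧ u ≠ z ∧ ¬ H.Adj z u}.ncard ≤
      {u | H.Adj y u ∧ u ≠ z ∧ ¬ H.Adj z u}.ncard := by
  have hex : ∀ u, ∃ w, H.Adj x u ∧ u ≠ z ∧ ¬ H.Adj z u → H.Adj u w ∧ H.Adj y w := by
    intro u
    by_cases hu : H.Adj x u ∧ u ≠ z ∧ ¬ H.Adj z u
    · have huy : u ≠ y := by
        rintro rfl
        exact h hu.1
      have huy' : ¬ H.Adj u y := fun hadj =>
        hu.2.1 (hH.eq_of_adj hxy h hu.1 hadj.symm hxz hyz)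
      obtain ⟨w, hw, -⟩ := hH u y huy huy'
      exact ⟨w, fun _ => hw⟩
    · exact ⟨u, fun hu' => absurd hu' hu⟩
  choose f hf using hex
  refine Set.ncard_le_ncard_of_injOn f ?_ ?_ (Set.toFinite _)
  · intro u hu
    obtain ⟨huw, hyw⟩ := hf u hu
    obtain ⟨hxu, huz, hzu⟩ := hu
    refine ⟨hyw, ?_, ?_⟩
    · intro hw
      exact hzu (hw ▸ huw).symm
    · intro hzw
      have hx : x = f u := hH.eq_of_adj huz (fun h' => hzu h'.symm) hxu.symm hxz.symm huw hzw
      exact h (hx ▸ hyw).symm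
  · intro u hu u' hu' heq
    obtain ⟨huw, hyw⟩ := hf u hu
    obtain ⟨huw', -⟩ := hf u' hu'
    rw [← heq] at huw'
    have hne : x ≠ f u := fun hx => h (hx ▸ hyw).symm
    have hnadj : ¬ H.Adj x (f u) := fun hx =>
      hu.2.2 (hH.eq_of_adj hxy h hx hyw hxz hyz ▸ huw).symm
    exact hH.eq_of_adj hne hnadj hu.1 huw.symm hu'.1 huw'.symm

variable [Finite V] {d : ℕ}

theorem ncard_commonNeighbors_eq_of_common_vertex (hH : H.UniqueCommonNeighbor)
    (hd : ∀ u, (H.neighborSet u).ncard = d) {x y z : V} (hxz : H.Adj x z) (hyz : H.Adj y z) :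
    (H.commonNeighbors x z).ncard = (H.commonNeighbors y z).ncard := by
  by_cases hxy : x = y
  · rw [hxy]
  by_cases h : H.Adj x y
  · have aux : ∀ {a b : V}, a ≠ b → H.Adj a z → H.Adj b z → H.Adj a b →
        H.commonNeighbors a z \ {b} ⊆ H.commonNeighbors b z \ {a} := by
      rintro a b - haz hbz hab w ⟨⟨haw, hzw⟩, hwb⟩
      simp only [mem_neighborSet] at haw hzw
      refine ⟨⟨?_, hzw⟩, fun hw => haw.ne hw.symm⟩
      by_contra hbw
      exact haz.ne (hH.eq_of_adj (Ne.symm hwb) hbw hab.symm haw.symm hbz hzw.symm)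
    have heq := (aux hxy hxz hyz h).antisymm (aux (Ne.symm hxy) hyz hxz h.symm)
    have h₁ := Set.ncard_sdiff_singleton_add_one
      (show y ∈ H.commonNeighbors x z from ⟨h, hyz.symm⟩) (Set.toFinite _)
    have h₂ := Set.ncard_sdiff_singleton_add_one
      (show x ∈ H.commonNeighbors y z from ⟨h.symm, hxz.symm⟩) (Set.toFinite _)
    rw [← h₁, ← h₂, heq]
  · have h₁ := hH.ncard_le_of_not_adj hxy h hxz hyz
    have h₂ := hH.ncard_le_of_not_adj (Ne.symm hxy) (fun h' => h h'.symm) hyz hxz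
    have h₃ := H.ncard_neighborSet_eq_add hxz
    have h₄ := H.ncard_neighborSet_eq_add hyz
    rw [hd] at h₃ h₄
    omega

/-- In a regular graph in which distinct non-adjacent vertices have a unique common neighbour,
the number of common neighbours of two adjacent vertices is constant. -/
theorem ncard_commonNeighbors_eq (hH : H.UniqueCommonNeighbor)
    (hd : ∀ u, (H.neighborSet u).ncard = d) {x y a b : V} (hxy : H.Adj x y) (hab : H.Adj a b) :
    (H.commonNeighbors x y).ncard = (H.commonNeighbors a b).ncard := by
  have key : ∀ {p q r : V}, H.Adj p q → H.Adj q r →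
      (H.commonNeighbors p q).ncard = (H.commonNeighbors q r).ncard := by
    intro p q r hpq hqr
    rw [H.commonNeighbors_symm q r]
    exact hH.ncard_commonNeighbors_eq_of_common_vertex hd hpq hqr.symm
  rw [H.commonNeighbors_symm x y]
  by_cases hxa : x = a
  · subst hxa
    exact key hxy.symm hab
  by_cases hadj : H.Adj x a
  · exact (key hxy.symm hadj).trans (key hadj hab)
  · obtain ⟨z, ⟨hxz, haz⟩, -⟩ := hH x a hxa hadj
    exact (key hxy.symm hxz).trans ((key hxz haz.symm).trans (key haz.symm hab))

end UniqueCommonNeighbor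

section Complement

variable [Fintype V] (G : SimpleGraph V)

theorem ncard_neighborSet_compl (u : V) :
    (G.neighborSet u).ncard + (Gᶜ.neighborSet u).ncard + 1 = Fintype.card V := by
  have h := Set.ncard_add_ncard_compl (insert u (G.neighborSet u))
  rw [Set.ncard_insert_of_notMem (by simp), Nat.card_eq_fintype_card] at h
  have heq : (insert u (G.neighborSet u))ᶜ = Gᶜ.neighborSet u := by
    ext w
    simp [eq_comm]
  rw [heq] at h
  omega

theorem ncard_add_ncard_compl_union_neighborSet (u w : V) :
    (G.neighborSet u).ncard + (G.neighborSet w).ncard +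
      ((G.neighborSet u ∪ G.neighborSet w)ᶜ).ncard =
      Fintype.card V + (G.commonNeighbors u w).ncard := by
  have h₁ := Set.ncard_union_add_ncard_inter (G.neighborSet u) (G.neighborSet w)
  have h₂ := Set.ncard_add_ncard_compl (G.neighborSet u ∪ G.neighborSet w)
  rw [Nat.card_eq_fintype_card] at h₂
  rw [commonNeighbors]
  omega

theorem ncard_add_ncard_commonNeighbors_compl_of_adj {u w : V} (h : G.Adj u w) :
    (G.neighborSet u).ncard + (G.neighborSet w).ncard + (Gᶜ.commonNeighbors u w).ncard =
      Fintype.card V + (G.commonNeighbors u w).ncard := by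
  rw [← ncard_add_ncard_compl_union_neighborSet]
  congr 2
  ext z
  simp only [mem_commonNeighbors, compl_adj, Set.mem_compl_iff, Set.mem_union, mem_neighborSet]
  have hu : u = z → G.Adj w z := fun e => e ▸ h.symm
  have hw : w = z → G.Adj u z := fun e => e ▸ h
  tauto

theorem ncard_add_ncard_commonNeighbors_compl_of_not_adj {u w : V} (hne : u ≠ w)
    (h : ¬ G.Adj u w) :
    (G.neighborSet u).ncard + (G.neighborSet w).ncard + ((Gᶜ.commonNeighbors u w).ncard + 2) =
      Fintype.card V + (G.commonNeighbors u w).ncard := by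
  rw [← ncard_add_ncard_compl_union_neighborSet]
  have hdisj : Disjoint (Gᶜ.commonNeighbors u w) {u, w} := by
    rw [Set.disjoint_left]
    rintro z ⟨hz, hz'⟩ (rfl | rfl)
    · exact Gᶜ.irrefl hz
    · exact Gᶜ.irrefl hz'
  rw [← Set.ncard_pair hne, ← Set.ncard_union_eq hdisj]
  congr 2
  ext z
  simp only [mem_commonNeighbors, compl_adj, Set.mem_compl_iff, Set.mem_union, mem_neighborSet,
    Set.mem_insert_iff, Set.mem_singleton_iff]
  have hu : z = u → ¬ G.Adj u z ∧ ¬ G.Adj w z := by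
    rintro rfl
    exact ⟨G.irrefl, fun h' => h h'.symm⟩
  have hw : z = w → ¬ G.Adj u z ∧ ¬ G.Adj w z := by
    rintro rfl
    exact ⟨h, G.irrefl⟩
  rw [ne_comm (a := u), ne_comm (a := w)]
  tauto

end Complement

end SimpleGraph

/-- If `Γ` is edge-regular with parameters `(v, k, λ)` and `v = 2k − λ + 1`, then `Γ`
is strongly regular. -/
theorem edgeRegular_of_v_eq_add_one {V : Type*} [Fintype V] (G : SimpleGraph V)
    (v k lam : ℕ) (h : IsEdgeRegular G v k lam) (hv : (v : ℤ) = 2 * k - lam + 1) :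
    ∃ mu : ℕ, IsStronglyRegular G v k lam mu := by
  obtain ⟨hcard, hbot, hreg, hadj⟩ := h
  have hcompl : ∀ {u w : V}, G.Adj u w → (Gᶜ.commonNeighbors u w).ncard = 1 := by
    intro u w huw
    have h := G.ncard_add_ncard_commonNeighbors_compl_of_adj huw
    rw [hreg, hreg, hadj u w huw, hcard] at h
    omega
  have hH : Gᶜ.UniqueCommonNeighbor := by
    intro x y hxy hnadj
    have hG : G.Adj x y := by
      by_contra hG
      exact hnadj ⟨hxy, hG⟩
    obtain ⟨z, hz⟩ := Set.ncard_eq_one.mp (hcompl hG)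
    have hmem : ∀ w, Gᶜ.Adj x w ∧ Gᶜ.Adj y w ↔ w = z := fun w => Set.ext_iff.mp hz w
    exact ⟨z, (hmem z).mpr rfl, fun w hw => (hmem w).mp hw⟩
  have hd : ∀ u, (Gᶜ.neighborSet u).ncard = v - 1 - k := by
    intro u
    have h := G.ncard_neighborSet_compl u
    rw [hreg, hcard] at h
    omega
  obtain ⟨x, y, hxy⟩ := SimpleGraph.ne_bot_iff_exists_adj.mp hbot
  obtain ⟨z, hz⟩ := Set.ncard_eq_one.mp (hcompl hxy)
  have hxz : Gᶜ.Adj x z := (hz.ge rfl).1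
  refine ⟨(G.commonNeighbors x z).ncard, hcard, hbot, ?_, hreg, hadj, ?_⟩
  · rintro rfl
    exact hxz.2 hxz.1
  · intro u w hne hnadj
    have h₁ := G.ncard_add_ncard_commonNeighbors_compl_of_not_adj hne hnadj
    have h₂ := G.ncard_add_ncard_commonNeighbors_compl_of_not_adj hxz.1 hxz.2
    have h₃ := hH.ncard_commonNeighbors_eq hd hxz (show Gᶜ.Adj u w from ⟨hne, hnadj⟩)
    simp only [hreg] at h₁ h₂
    omega
end

section
/- Suppose there exists a strongly regular graph with parameters (v, v − k − 1, 0, v − 2k + λ). Then every edge-regular graph with parameters (v, k, λ) is strongly regular. -/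
namespace SimpleGraph

variable {V : Type*} [Fintype V]

/-- Inclusion–exclusion for the common non-neighbours of two adjacent vertices. -/
theorem ncard_commonNeighbors_compl_of_adj (G : SimpleGraph V) {u w : V} (h : G.Adj u w) :
    (Gᶜ.commonNeighbors u w).ncard + (G.neighborSet u).ncard + (G.neighborSet w).ncard =
      Fintype.card V + (G.commonNeighbors u w).ncard := by
  have hc : Gᶜ.commonNeighbors u w = (G.neighborSet u ∪ G.neighborSet w)ᶜ := by
    ext x
    simp only [mem_commonNeighbors, compl_adj, Set.mem_compl_iff, Set.mem_union, mem_neighborSet]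
    constructor
    · rintro ⟨⟨-, h₁⟩, -, h₂⟩
      exact not_or.mpr ⟨h₁, h₂⟩
    · intro hx
      obtain ⟨h₁, h₂⟩ := not_or.mp hx
      refine ⟨⟨?_, h₁⟩, ?_, h₂⟩
      · rintro rfl
        exact h₂ h.symm
      · rintro rfl
        exact h₁ h
  have h₁ := Set.ncard_union_add_ncard_inter (G.neighborSet u) (G.neighborSet w)
  have h₂ := Set.ncard_add_ncard_compl (G.neighborSet u ∪ G.neighborSet w)
  rw [Nat.card_eq_fintype_card] at h₂
  rw [hc]
  change _ = _ + (G.neighborSet u ∩ G.neighborSet w).ncard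
  omega

theorem ncard_neighborSet_compl_add (G : SimpleGraph V) (u : V) :
    (Gᶜ.neighborSet u).ncard + (G.neighborSet u).ncard + 1 = Fintype.card V := by
  classical
  have h := G.degree_compl u
  have h' := G.degree_lt_card_verts u
  rw [← Nat.card_coe_set_eq, ← Nat.card_coe_set_eq, Nat.card_eq_fintype_card,
    Nat.card_eq_fintype_card, card_neighborSet_eq_degree, card_neighborSet_eq_degree]
  omega

/-- Counting walks of length two that start at `u`. -/
theorem sum_ncard_commonNeighbors (G : SimpleGraph V) {d : ℕ}
    (hd : ∀ x, (G.neighborSet x).ncard = d) (u : V) :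
    ∑ w, (G.commonNeighbors u w).ncard = d * d := by
  classical
  have h₁ (w : V) : (G.commonNeighbors u w).ncard =
      ∑ x, if G.Adj u x ∧ G.Adj x w then 1 else 0 := by
    rw [← Finset.card_filter, ← Set.ncard_coe_finset]
    congr 1
    ext x
    simp [mem_commonNeighbors, G.adj_comm x w]
  have h₂ (x : V) : ∑ w, (if G.Adj x w then 1 else 0) = d := by
    rw [← Finset.card_filter, ← Set.ncard_coe_finset, ← hd x]
    congr 1
    ext w
    simp
  simp_rw [h₁]
  rw [Finset.sum_comm]
  simp_rw [ite_and]
  have h₃ (x : V) : ∑ w, (if G.Adj u x then (if G.Adj x w then 1 else 0) else 0) =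
      (if G.Adj u x then 1 else 0) * d := by
    split_ifs
    · rw [h₂, one_mul]
    · simp
  simp_rw [h₃]
  rw [← Finset.sum_mul, h₂]

/-- In a `d`-regular graph in which distinct non-adjacent vertices have `mu` common neighbours,
the walks of length two from `u` are split according to their other end. -/
theorem sum_ncard_commonNeighbors_adj (G : SimpleGraph V) {d mu : ℕ}
    (hd : ∀ x, (G.neighborSet x).ncard = d)
    (hmu : ∀ u w, u ≠ w → ¬ G.Adj u w → (G.commonNeighbors u w).ncard = mu) (u : V) :
    d + ∑ w ∈ (G.neighborSet u).toFinite.toFinset, (G.commonNeighbors u w).ncard +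
      (Fintype.card V - d - 1) * mu = d * d := by
  classical
  have hs : (Gᶜ.neighborSet u).toFinite.toFinset.card = Fintype.card V - d - 1 := by
    have h := G.ncard_neighborSet_compl_add u
    rw [hd, Set.ncard_eq_toFinset_card] at h
    omega
  have huniv : (Finset.univ : Finset V) =
      insert u ((G.neighborSet u).toFinite.toFinset ∪ (Gᶜ.neighborSet u).toFinite.toFinset) := by
    ext w
    simp only [Finset.mem_univ, Finset.mem_insert, Finset.mem_union, Set.Finite.mem_toFinset,
      mem_neighborSet, compl_adj, true_iff]
    tauto
  have hdisj : Disjoint (G.neighborSet u).toFinite.toFinset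
      (Gᶜ.neighborSet u).toFinite.toFinset := by
    rw [Finset.disjoint_left]
    intro w
    simp only [Set.Finite.mem_toFinset, mem_neighborSet, compl_adj]
    tauto
  rw [← G.sum_ncard_commonNeighbors hd u, huniv, Finset.sum_insert (by simp),
    Finset.sum_union hdisj, ← hs, ← smul_eq_mul, ← Finset.sum_const, add_assoc]
  congr 1
  · rw [← hd u]
    congr 1
    exact (Set.inter_self _).symm
  · congr 1
    refine Finset.sum_congr rfl fun w hw ↦ (hmu u w ?_ ?_).symm <;>
    · simp only [Set.Finite.mem_toFinset, mem_neighborSet, compl_adj] at hw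
      tauto

end SimpleGraph

/-- If there exists a strongly regular graph with parameters
`(v, v − k − 1, 0, v − 2k + λ)`, then every edge-regular graph with parameters
`(v, k, λ)` is strongly regular. -/
theorem edgeRegular_srg_of_srg_exists (v k lam : ℕ)
    (h : ∃ (W : Type) (_ : Fintype W) (H : SimpleGraph W) (mu : ℕ),
      (mu : ℤ) = (v : ℤ) - 2 * k + lam ∧ IsStronglyRegular H v (v - k - 1) 0 mu) :
    ∀ (V : Type) [Fintype V] (G : SimpleGraph V), IsEdgeRegular G v k lam →
      ∃ mu : ℕ, IsStronglyRegular G v k lam mu := by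
  obtain ⟨W, _, H, mu, hmu, hW, hbot, -, hHd, hHadj, hHmu⟩ := h
  intro V _ G ⟨hV, hG, hk, hlam⟩
  set d := v - k - 1 with hd
  have hd_pos : 0 < d := by
    obtain ⟨a, b, hab⟩ := SimpleGraph.ne_bot_iff_exists_adj.mp hbot
    rw [← hHd a]
    exact (Set.ncard_pos).mpr ⟨b, hab⟩
  obtain ⟨a, -, -⟩ := SimpleGraph.ne_bot_iff_exists_adj.mp hbot
  have hGd (u : V) : (Gᶜ.neighborSet u).ncard = d := by
    have := G.ncard_neighborSet_compl_add u
    rw [hk, hV] at this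
    omega
  have hGmu (u w : V) (hne : u ≠ w) (h : ¬ Gᶜ.Adj u w) :
      (Gᶜ.commonNeighbors u w).ncard = mu := by
    have hadj : G.Adj u w := by
      by_contra hn
      exact h ((G.compl_adj u w).mpr ⟨hne, hn⟩)
    have := G.ncard_commonNeighbors_compl_of_adj hadj
    rw [hk, hk, hV, hlam u w hadj] at this
    omega
  have hH := H.sum_ncard_commonNeighbors_adj hHd hHmu a
  rw [Finset.sum_eq_zero fun w hw ↦ hHadj a w (by simpa using hw), hW] at hH
  have hGadj (u w : V) (h : Gᶜ.Adj u w) : (Gᶜ.commonNeighbors u w).ncard = 0 := by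
    have hu := Gᶜ.sum_ncard_commonNeighbors_adj hGd hGmu u
    rw [hV] at hu
    have hsum : ∑ x ∈ (Gᶜ.neighborSet u).toFinite.toFinset,
        (Gᶜ.commonNeighbors u x).ncard = 0 := by omega
    exact Finset.sum_eq_zero_iff.mp hsum w (by simpa using h)
  refine ⟨v - 2 * d, hV, hG, ?_, hk, hlam, fun u w hne h ↦ ?_⟩
  · rintro rfl
    obtain ⟨u, -, -⟩ := SimpleGraph.ne_bot_iff_exists_adj.mp hG
    have := hGd u
    obtain ⟨w, hw⟩ := (Set.ncard_pos).mp (this ▸ hd_pos)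
    simp at hw
  · have hadj : Gᶜ.Adj u w := (G.compl_adj u w).mpr ⟨hne, h⟩
    have := Gᶜ.ncard_commonNeighbors_compl_of_adj hadj
    rw [compl_compl, hGd, hGd, hGadj u w hadj, hV] at this
    omega
end

section
/- Let Γ be a Neumaier graph with parameters (v, k, λ; m, s) such that k − λ − s + m − 1 = 0. Then every vertex of Γ has a neighbourhood consisting of two vertex-disjoint cliques of size s − 1, and Γ is strongly regular with parameters v = s + s(s − 1)/m, k = 2(s − 1), λ = s + m − 3 and μ = 2m. -/
open Classical in
theorem SimpleGraph.IsClique.neighborFinset_inter_eq_erase {V : Type*} [Fintype V]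
    {G : SimpleGraph V} {T : Finset V} (hT : G.IsClique ↑T) {u : V} (hu : u ∈ T) :
    G.neighborFinset u ∩ T = T.erase u := by
  ext x
  simp only [Finset.mem_inter, SimpleGraph.mem_neighborFinset, Finset.mem_erase]
  exact ⟨fun h => ⟨h.1.ne', h.2⟩, fun h => ⟨hT hu h.2 h.1.symm, h.2⟩⟩

open Classical in
/-- First moment of the number of neighbours in a clique `T`, over the vertices outside `T`. -/
theorem SimpleGraph.IsClique.sum_card_neighborFinset_inter {V : Type*} [Fintype V]
    {G : SimpleGraph V} {k : ℕ} (hk : ∀ u : V, (G.neighborFinset u).card = k)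
    {T : Finset V} (hT : G.IsClique ↑T) :
    ∑ w ∈ Tᶜ, ((G.neighborFinset w ∩ T).card : ℤ) = T.card * (k - (T.card - 1)) := by
  have hin : ∀ w ∈ T, ((G.neighborFinset w ∩ T).card : ℤ) = T.card - 1 := by
    intro w hw
    rw [hT.neighborFinset_inter_eq_erase hw, Finset.card_erase_of_mem hw]
    have := Finset.card_pos.2 ⟨w, hw⟩
    omega
  have hsplit := Finset.sum_add_sum_compl T
    fun w => ((G.neighborFinset w ∩ T).card : ℤ)
  rw [Finset.sum_congr rfl hin, Finset.sum_const, nsmul_eq_mul] at hsplit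
  have hall : ∑ w, ((G.neighborFinset w ∩ T).card : ℤ) = T.card * k := by
    have hn : ∀ w, ((G.neighborFinset w ∩ T).card : ℤ)
        = ∑ x ∈ T, if w ∈ G.neighborFinset x then 1 else 0 := by
      intro w
      rw [Finset.sum_boole, Finset.inter_comm, ← Finset.filter_mem_eq_inter]
      simp [SimpleGraph.adj_comm]
    simp_rw [hn]
    rw [Finset.sum_comm]
    simp_rw [Finset.sum_boole, Finset.filter_mem_eq_inter, Finset.univ_inter, hk]
    simp
  rw [hall] at hsplit
  linear_combination hsplit

open Classical in
/-- Second moment of the number of neighbours in a clique `T`, over the vertices outside `T`. -/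
theorem SimpleGraph.IsClique.sum_sq_card_neighborFinset_inter {V : Type*} [Fintype V]
    {G : SimpleGraph V} {k lam : ℕ} (hk : ∀ u : V, (G.neighborFinset u).card = k)
    (hlam : ∀ u w, G.Adj u w → (G.neighborFinset u ∩ G.neighborFinset w).card = lam)
    {T : Finset V} (hT : G.IsClique ↑T) :
    ∑ w ∈ Tᶜ, ((G.neighborFinset w ∩ T).card : ℤ) ^ 2
      = T.card * (k + (T.card - 1) * lam - (T.card - 1) ^ 2) := by
  have hin : ∀ w ∈ T, ((G.neighborFinset w ∩ T).card : ℤ) ^ 2 = (T.card - 1) ^ 2 := by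
    intro w hw
    rw [hT.neighborFinset_inter_eq_erase hw, Finset.card_erase_of_mem hw, Nat.cast_sub (Finset.card_pos.2 ⟨w, hw⟩)]
    simp
  have hsplit := Finset.sum_add_sum_compl T
    fun w => ((G.neighborFinset w ∩ T).card : ℤ) ^ 2
  rw [Finset.sum_congr rfl hin, Finset.sum_const, nsmul_eq_mul] at hsplit
  have hall : ∑ w, ((G.neighborFinset w ∩ T).card : ℤ) ^ 2
      = T.card * (k + (T.card - 1) * lam) := by
    have hn : ∀ w, ((G.neighborFinset w ∩ T).card : ℤ) ^ 2
        = ∑ x ∈ T, ∑ y ∈ T, if w ∈ G.neighborFinset x ∩ G.neighborFinset y then 1 else 0 := by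
      intro w
      have h1 : ((G.neighborFinset w ∩ T).card : ℤ)
          = ∑ x ∈ T, if w ∈ G.neighborFinset x then 1 else 0 := by
        rw [Finset.sum_boole, Finset.inter_comm, ← Finset.filter_mem_eq_inter]
        simp [SimpleGraph.adj_comm]
      rw [h1, sq, Finset.sum_mul_sum]
      refine Finset.sum_congr rfl fun x _ => Finset.sum_congr rfl fun y _ => ?_
      simp only [Finset.mem_inter]
      split_ifs <;> simp_all
    have hx : ∀ x ∈ T, ∑ y ∈ T, ((G.neighborFinset x ∩ G.neighborFinset y).card : ℤ)
        = k + (T.card - 1) * lam := by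
      intro x hx
      rw [← Finset.add_sum_erase T _ hx, Finset.inter_self, hk]
      rw [Finset.sum_congr rfl (g := fun _ => (lam : ℤ)), Finset.sum_const,
        Finset.card_erase_of_mem hx, nsmul_eq_mul, Nat.cast_sub (Finset.card_pos.2 ⟨x, hx⟩)]
      · simp
      · intro y hy
        rw [Finset.mem_erase] at hy
        rw [hlam x y (hT hx hy.2 hy.1.symm)]
    simp_rw [hn]
    rw [Finset.sum_comm]
    simp_rw [Finset.sum_comm (s := Finset.univ), Finset.sum_boole, Finset.filter_mem_eq_inter,
      Finset.univ_inter]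
    rw [Finset.sum_congr rfl hx]
    simp
  rw [hall] at hsplit
  linear_combination hsplit

open Classical in
/-- In an edge-regular graph with an `m`-regular clique, every clique of the same size is
`m`-regular. -/
theorem card_neighborFinset_inter_eq_of_card_eq {V : Type*} [Fintype V]
    {G : SimpleGraph V} {k lam m : ℕ} (hk : ∀ u : V, (G.neighborFinset u).card = k)
    (hlam : ∀ u w, G.Adj u w → (G.neighborFinset u ∩ G.neighborFinset w).card = lam)
    {S T : Finset V} (hS : G.IsClique ↑S) (hT : G.IsClique ↑T) (hST : T.card = S.card)
    (hm : ∀ w ∉ S, (G.neighborFinset w ∩ S).card = m) :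
    ∀ w ∉ T, (G.neighborFinset w ∩ T).card = m := by
  have expand : ∀ U : Finset V, ∑ w ∈ Uᶜ, (((G.neighborFinset w ∩ U).card : ℤ) - m) ^ 2
      = ∑ w ∈ Uᶜ, ((G.neighborFinset w ∩ U).card : ℤ) ^ 2
        - 2 * m * ∑ w ∈ Uᶜ, ((G.neighborFinset w ∩ U).card : ℤ) + Uᶜ.card * m ^ 2 := by
    intro U
    rw [Finset.mul_sum, ← Finset.sum_sub_distrib, ← nsmul_eq_mul, ← Finset.sum_const,
      ← Finset.sum_add_distrib]
    exact Finset.sum_congr rfl fun w _ => by ring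
  have hS0 : ∑ w ∈ Sᶜ, (((G.neighborFinset w ∩ S).card : ℤ) - m) ^ 2 = 0 :=
    Finset.sum_eq_zero fun w hw => by rw [hm w (Finset.mem_compl.1 hw)]; simp
  have hT0 : ∑ w ∈ Tᶜ, (((G.neighborFinset w ∩ T).card : ℤ) - m) ^ 2 = 0 := by
    rw [← hS0, expand, expand, hS.sum_card_neighborFinset_inter hk,
      hT.sum_card_neighborFinset_inter hk, hS.sum_sq_card_neighborFinset_inter hk hlam,
      hT.sum_sq_card_neighborFinset_inter hk hlam, Finset.card_compl, Finset.card_compl, hST]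
  intro w hw
  have := (Finset.sum_eq_zero_iff_of_nonneg fun w _ => sq_nonneg _).1 hT0 w
    (Finset.mem_compl.2 hw)
  have := pow_eq_zero_iff (two_ne_zero) |>.1 this
  omega

open Classical in
/-- If `k = lam + s - m + 1`, the neighbours outside an `m`-regular `s`-clique `T` of a vertex
in `T` form a clique. -/
theorem isClique_neighborFinset_sdiff {V : Type*} [Fintype V]
    {G : SimpleGraph V} {k lam m : ℕ} (hk : ∀ u : V, (G.neighborFinset u).card = k)
    (hlam : ∀ u w, G.Adj u w → (G.neighborFinset u ∩ G.neighborFinset w).card = lam)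
    {T : Finset V} (hT : G.IsClique ↑T)
    (hm : ∀ w ∉ T, (G.neighborFinset w ∩ T).card = m)
    (heq : k + m = lam + T.card + 1) {u : V} (hu : u ∈ T) :
    G.IsClique ↑(G.neighborFinset u \ T) := by
  intro w hw z hz hwz
  by_contra hadj
  simp only [Finset.coe_sdiff, Set.mem_sdiff, Finset.mem_coe,
    SimpleGraph.mem_neighborFinset] at hw hz
  have hd1 : Disjoint (G.neighborFinset u ∩ G.neighborFinset w) {w, z} := by
    rw [Finset.disjoint_left]
    intro x hx hx'
    simp only [Finset.mem_inter, SimpleGraph.mem_neighborFinset, Finset.mem_insert,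
      Finset.mem_singleton] at hx hx'
    rcases hx' with rfl | rfl
    · exact hx.2.ne rfl
    · exact hadj hx.2
  have hd2 : Disjoint (G.neighborFinset u ∩ G.neighborFinset w ∪ {w, z})
      (T \ G.neighborFinset w) := by
    rw [Finset.disjoint_left]
    intro x hx hx'
    simp only [Finset.mem_inter, Finset.mem_union, Finset.mem_insert, Finset.mem_sdiff,
      Finset.mem_singleton] at hx hx'
    rcases hx with hx | rfl | rfl
    · exact hx'.2 hx.2
    · exact hw.2 hx'.1
    · exact hz.2 hx'.1
  have hsub : (G.neighborFinset u ∩ G.neighborFinset w ∪ {w, z}) ∪ (T \ G.neighborFinset w)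
      ⊆ G.neighborFinset u := by
    intro x hx
    simp only [Finset.mem_inter, Finset.mem_union, Finset.mem_insert, Finset.mem_sdiff,
      Finset.mem_singleton, SimpleGraph.mem_neighborFinset] at hx ⊢
    rcases hx with (hx | rfl | rfl) | hx
    · exact hx.1
    · exact hw.1
    · exact hz.1
    · refine hT hu hx.1 ?_
      rintro rfl
      exact hx.2 hw.1.symm
  have hcard := Finset.card_le_card hsub
  rw [Finset.card_union_of_disjoint hd2, Finset.card_union_of_disjoint hd1, hk,
    hlam u w hw.1, Finset.card_pair hwz] at hcard
  have h1 := Finset.card_sdiff_add_card_inter T (G.neighborFinset w)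
  rw [Finset.inter_comm, hm w hw.2] at h1
  omega

/-- A regular graph with a vertex adjacent to all others is complete. -/
theorem SimpleGraph.eq_top_of_forall_adj {V : Type*} [Fintype V]
    {G : SimpleGraph V} {k : ℕ} (hk : ∀ u : V, (G.neighborSet u).ncard = k) {u : V}
    (hu : ∀ w, u ≠ w → G.Adj u w) : G = ⊤ := by
  have huniv : ∀ w : V, ({w}ᶜ : Set V).ncard = Nat.card V - 1 := fun w => by
    rw [Set.ncard_compl, Set.ncard_singleton]
  have hsub : ∀ w, G.neighborSet w ⊆ {w}ᶜ := fun w x hx => (G.ne_of_adj hx).symm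
  have hku : k = Nat.card V - 1 := by
    rw [← hk u, ← huniv u]
    congr 1
    exact (hsub u).antisymm fun x hx => hu x (Ne.symm hx)
  have heq : ∀ w, G.neighborSet w = {w}ᶜ := fun w =>
    Set.eq_of_subset_of_ncard_le (hsub w) (by rw [hk, huniv, hku])
  ext x y
  rw [SimpleGraph.top_adj, ← SimpleGraph.mem_neighborSet, heq]
  exact ne_comm

/-- If `Γ` is a Neumaier graph with parameters `(v, k, λ; m, s)` and
`k − λ − s + m − 1 = 0`, then every vertex of `Γ` has a neighbourhood consisting of two
vertex-disjoint cliques of size `s − 1`, and `Γ` is strongly regular with parameters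
`v = s + s(s − 1)/m`, `k = 2(s − 1)`, `λ = s + m − 3` and `μ = 2m`. -/
theorem neumaier_equality_case {V : Type*} [Fintype V] (G : SimpleGraph V)
    (v k lam m s : ℕ) (h : IsNeumaier G v k lam m s)
    (heq : (k : ℤ) - lam - s + m - 1 = 0) :
    (∀ u : V, ∃ C₁ C₂ : Finset V, Disjoint C₁ C₂ ∧
      G.IsClique ↑C₁ ∧ C₁.card = s - 1 ∧ G.IsClique ↑C₂ ∧ C₂.card = s - 1 ∧
      G.neighborSet u = ↑C₁ ∪ ↑C₂) ∧
    IsStronglyRegular G v k lam (2 * m) ∧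
      (v : ℚ) = (s : ℚ) + (s : ℚ) * ((s : ℚ) - 1) / (m : ℚ) ∧
      (k : ℤ) = 2 * ((s : ℤ) - 1) ∧
      (lam : ℤ) = (s : ℤ) + m - 3 := by
  classical
  obtain ⟨⟨hv, hbot, hk', hlam'⟩, htop, hs, S, hS, hScard, hm0, hm'⟩ := h
  have hk : ∀ u : V, (G.neighborFinset u).card = k := fun u => by
    rw [← hk' u, ← Set.ncard_coe_finset, SimpleGraph.coe_neighborFinset]
  have hlam : ∀ u w, G.Adj u w → (G.neighborFinset u ∩ G.neighborFinset w).card = lam :=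
    fun u w huw => by
      rw [← hlam' u w huw, ← Set.ncard_coe_finset, Finset.coe_inter,
        SimpleGraph.coe_neighborFinset, SimpleGraph.coe_neighborFinset, SimpleGraph.commonNeighbors]
  have hm : ∀ w ∉ S, (G.neighborFinset w ∩ S).card = m := fun w hw => by
    rw [← hm' w hw, ← Set.ncard_coe_finset, Finset.coe_inter, SimpleGraph.coe_neighborFinset]
  have hms : (m : ℤ) ≠ s := by
    intro hms
    obtain ⟨u, hu⟩ : S.Nonempty := Finset.card_pos.1 (by omega)
    refine htop (SimpleGraph.eq_top_of_forall_adj hk' (u := u) fun w huw => ?_)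
    by_cases hw : w ∈ S
    · exact hS hu hw huw
    · have : G.neighborFinset w ∩ S = S :=
        Finset.eq_of_subset_of_card_le Finset.inter_subset_right (by rw [hm w hw]; omega)
      have hu' := this ▸ hu
      rw [Finset.mem_inter, SimpleGraph.mem_neighborFinset] at hu'
      exact hu'.1.symm
  have first := hS.sum_card_neighborFinset_inter hk
  have second := hS.sum_sq_card_neighborFinset_inter hk hlam
  rw [Finset.sum_congr rfl fun w hw => by rw [hm w (Finset.mem_compl.1 hw)], Finset.sum_const,
    nsmul_eq_mul, hScard, Finset.card_compl, hv, hScard,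
    Nat.cast_sub (by rw [← hv, ← hScard]; exact S.card_le_univ)] at first second
  have hs0 : (s : ℤ) ≠ 0 := by omega
  have hkval : (k : ℤ) = 2 * ((s : ℤ) - 1) := by
    have hprod : (s : ℤ) * (((m : ℤ) - s) * (k - 2 * (s - 1))) = 0 := by
      linear_combination second - m * first - (s : ℤ) * (s - 1) * heq
    have := (mul_eq_zero.1 ((mul_eq_zero.1 hprod).resolve_left hs0)).resolve_left
      (sub_ne_zero.2 hms)
    omega
  have hreg : ∀ T : Finset V, G.IsClique ↑T → T.card = s →
      ∀ w ∉ T, (G.neighborFinset w ∩ T).card = m := fun T hT hTs =>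
    card_neighborFinset_inter_eq_of_card_eq hk hlam hS hT (hTs.trans hScard.symm) hm
  have hother : ∀ T : Finset V, G.IsClique ↑T → T.card = s → ∀ u ∈ T,
      G.IsClique ↑(G.neighborFinset u \ T) ∧ (G.neighborFinset u \ T).card = s - 1 ∧
      G.IsClique ↑(insert u (G.neighborFinset u \ T)) ∧
      (insert u (G.neighborFinset u \ T)).card = s ∧ T.erase u ⊆ G.neighborFinset u := by
    intro T hT hTs u hu
    have hc := isClique_neighborFinset_sdiff hk hlam hT (hreg T hT hTs) (by omega) hu
    have hi := hT.neighborFinset_inter_eq_erase hu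
    have hsub : T.erase u ⊆ G.neighborFinset u := hi ▸ Finset.inter_subset_left
    have hcard := Finset.card_sdiff_add_card_inter (G.neighborFinset u) T
    rw [hi, hk, Finset.card_erase_of_mem hu, hTs] at hcard
    refine ⟨hc, by omega, ?_, ?_, hsub⟩
    · rw [Finset.coe_insert]
      refine hc.insert fun b hb _ => ?_
      have := (Finset.mem_sdiff.1 hb).1
      exact (G.mem_neighborFinset u b).1 this
    · rw [Finset.card_insert_of_notMem (by simp)]
      omega
  have hcover : ∀ u : V, ∃ T : Finset V, G.IsClique ↑T ∧ T.card = s ∧ u ∈ T := by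
    intro u
    by_cases hu : u ∈ S
    · exact ⟨S, hS, hScard, hu⟩
    · obtain ⟨x, hx⟩ : (G.neighborFinset u ∩ S).Nonempty :=
        Finset.card_pos.1 (by rw [hm u hu]; exact hm0)
      rw [Finset.mem_inter, SimpleGraph.mem_neighborFinset] at hx
      obtain ⟨-, -, hcl, hcard, -⟩ := hother S hS hScard x hx.2
      refine ⟨_, hcl, hcard, Finset.mem_insert_of_mem ?_⟩
      simp [hu, hx.1.symm]
  refine ⟨fun u => ?_, ⟨hv, hbot, htop, hk', hlam', fun u w huw hadj => ?_⟩, ?_, hkval, ?_⟩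
  · obtain ⟨T, hT, hTs, hu⟩ := hcover u
    obtain ⟨hc, hcard, -, -, hsub⟩ := hother T hT hTs u hu
    refine ⟨T.erase u, G.neighborFinset u \ T, ?_, hT.subset (by simp), ?_, hc, hcard, ?_⟩
    · exact Finset.disjoint_sdiff.mono_left (Finset.erase_subset u T)
    · rw [Finset.card_erase_of_mem hu, hTs]
    · ext x
      have := @hsub x
      have hne : G.Adj u x → x ≠ u := fun h => h.ne'
      simp only [Set.mem_union, Finset.mem_coe, Finset.mem_sdiff, Finset.mem_erase,
        SimpleGraph.mem_neighborFinset, SimpleGraph.mem_neighborSet] at this ⊢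
      tauto
  · obtain ⟨T, hT, hTs, hu⟩ := hcover u
    obtain ⟨-, -, hcl, hcard, hsub⟩ := hother T hT hTs u hu
    have hwT : w ∉ T := fun hw => hadj (hT hu hw huw)
    have hwT' : w ∉ insert u (G.neighborFinset u \ T) := by
      simp [huw.symm, hadj]
    have h1 := hreg T hT hTs w hwT
    have h2 := hreg _ hcl hcard w hwT'
    have hdisj : Disjoint (G.neighborFinset w ∩ T)
        (G.neighborFinset w ∩ insert u (G.neighborFinset u \ T)) := by
      rw [Finset.disjoint_left]
      intro x hx hx'
      simp only [Finset.mem_inter, Finset.mem_insert, Finset.mem_sdiff,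
        SimpleGraph.mem_neighborFinset] at hx hx'
      rcases hx'.2 with rfl | h
      · exact hadj hx.1.symm
      · exact h.2 hx.2
    have hunion : G.commonNeighbors u w = ↑((G.neighborFinset w ∩ T) ∪
        (G.neighborFinset w ∩ insert u (G.neighborFinset u \ T))) := by
      ext x
      have := @hsub x
      have hne : G.Adj w x → x ≠ u := by
        rintro h rfl
        exact hadj h.symm
      simp only [SimpleGraph.mem_commonNeighbors, Finset.mem_coe, Finset.mem_union,
        Finset.mem_inter, Finset.mem_insert, Finset.mem_sdiff, Finset.mem_erase,
        SimpleGraph.mem_neighborFinset] at this ⊢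
      tauto
    rw [hunion, Set.ncard_coe_finset, Finset.card_union_of_disjoint hdisj, h1, h2, two_mul]
  · have hm0' : (m : ℚ) ≠ 0 := by exact_mod_cast hm0.ne'
    rw [hkval] at first
    have first' : ((v : ℚ) - s) * m = s * (2 * (s - 1) - (s - 1)) := by exact_mod_cast first
    field_simp
    linear_combination first'
  · omega
end

section
/- Let Γ be a Neumaier graph with parameters (v, k, λ; m, s) such that k − λ − s + m − 1 = 0. Then Γ is isomorphic to one of the following graphs: the square lattice graph L₂(s); the triangular graph T(s + 1) with s ≥ 3; or the complete multipartite graph K_{s×2} with s parts of size 2. -/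
/-- The square lattice graph `L₂(n)`: vertex set `Fin n × Fin n`, two distinct vertices
adjacent iff they agree in exactly one coordinate. -/
def squareLatticeGraph (n : ℕ) : SimpleGraph (Fin n × Fin n) :=
  SimpleGraph.fromRel (fun a b => (a.1 = b.1 ∧ a.2 ≠ b.2) ∨ (a.1 ≠ b.1 ∧ a.2 = b.2))

/-- The triangular graph `T(n)`: vertex set the 2-element subsets of `{1, …, n}`, two
distinct vertices `A`, `B` adjacent iff `|A ∩ B| = 1`. -/
def triangularGraph (n : ℕ) : SimpleGraph {A : Finset (Fin n) // A.card = 2} :=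
  SimpleGraph.fromRel (fun A B => (A.1 ∩ B.1).card = 1)

open Finset

/-- A regular graph of degree `2s - 2`, in which adjacent vertices have `s + m - 3` common
neighbours, together with an `m`-regular `s`-clique `S`, where `0 < m < s`. -/
structure IsTightClique {V : Type*} [Fintype V] [DecidableEq V] (G : SimpleGraph V)
    [DecidableRel G.Adj] (S : Finset V) (m s : ℕ) : Prop where
  clique : ∀ x ∈ S, ∀ y ∈ S, x ≠ y → G.Adj x y
  card_eq : #S = s
  pos : 0 < m
  lt : m < s
  degree : ∀ u, #(G.neighborFinset u) + 2 = 2 * s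
  common : ∀ u w, G.Adj u w → #(G.neighborFinset u ∩ G.neighborFinset w) + 3 = s + m
  nexus : ∀ u ∉ S, #(G.neighborFinset u ∩ S) = m

section Counting

variable {V : Type*} [Fintype V] [DecidableEq V] {G : SimpleGraph V} [DecidableRel G.Adj]
  {S : Finset V}

lemma card_neighborFinset_sdiff_of_clique (hS : ∀ x ∈ S, ∀ y ∈ S, x ≠ y → G.Adj x y) {x : V}
    (hx : x ∈ S) : #(G.neighborFinset x \ S) + #S = #(G.neighborFinset x) + 1 := by
  have h1 : G.neighborFinset x ∩ S = S.erase x := by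
    ext y
    simp only [mem_inter, SimpleGraph.mem_neighborFinset, mem_erase]
    exact ⟨fun h => ⟨h.1.ne', h.2⟩, fun h => ⟨hS x hx y h.2 h.1.symm, h.2⟩⟩
  have h2 := card_sdiff_add_card_inter (G.neighborFinset x) S
  rw [h1] at h2
  have := card_erase_add_one hx
  omega

lemma card_commonNeighbors_sdiff_of_clique (hS : ∀ x ∈ S, ∀ y ∈ S, x ≠ y → G.Adj x y) {x y : V}
    (hx : x ∈ S) (hy : y ∈ S) (hxy : x ≠ y) :
    #((G.neighborFinset x \ S) ∩ (G.neighborFinset y \ S)) + #S =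
      #(G.neighborFinset x ∩ G.neighborFinset y) + 2 := by
  have h1 : (G.neighborFinset x ∩ G.neighborFinset y) ∩ S = (S.erase x).erase y := by
    ext z
    simp only [mem_inter, SimpleGraph.mem_neighborFinset, mem_erase]
    exact ⟨fun h => ⟨h.1.2.ne', h.1.1.ne', h.2⟩,
      fun h => ⟨⟨hS x hx z h.2.2 h.2.1.symm, hS y hy z h.2.2 h.1.symm⟩, h.2.2⟩⟩
  have h2 := card_sdiff_add_card_inter (G.neighborFinset x ∩ G.neighborFinset y) S
  have h3 : (G.neighborFinset x ∩ G.neighborFinset y) \ S =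
      (G.neighborFinset x \ S) ∩ (G.neighborFinset y \ S) := by
    ext z
    simp only [mem_inter, mem_sdiff]
    tauto
  rw [h1, h3] at h2
  have h4 := card_erase_add_one hx
  have h5 := card_erase_add_one (mem_erase.2 ⟨hxy.symm, hy⟩)
  omega

/-- Counting the edges between `S \ {x}` and the neighbours of `x` outside `S` in two ways. -/
lemma sum_card_commonNeighbors_sdiff {m : ℕ} {x : V} (hx : x ∈ S)
    (hm : ∀ u ∉ S, #(G.neighborFinset u ∩ S) = m) :
    ∑ y ∈ S.erase x, #((G.neighborFinset x \ S) ∩ (G.neighborFinset y \ S)) =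
      #(G.neighborFinset x \ S) * (m - 1) := by
  have h := sum_card_bipartiteAbove_eq_sum_card_bipartiteBelow G.Adj
    (s := S.erase x) (t := G.neighborFinset x \ S)
  have h1 : ∀ y ∈ S.erase x, #((G.neighborFinset x \ S) ∩ (G.neighborFinset y \ S)) =
      #(bipartiteAbove G.Adj (G.neighborFinset x \ S) y) := by
    intro y _
    congr 1
    ext z
    simp only [mem_inter, mem_sdiff, SimpleGraph.mem_neighborFinset, mem_bipartiteAbove]
    tauto
  have h2 : ∀ u ∈ G.neighborFinset x \ S, #(bipartiteBelow G.Adj (S.erase x) u) = m - 1 := by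
    intro u hu
    rw [mem_sdiff, SimpleGraph.mem_neighborFinset] at hu
    have h3 : bipartiteBelow G.Adj (S.erase x) u = (G.neighborFinset u ∩ S).erase x := by
      ext z
      simp only [mem_inter, mem_erase, SimpleGraph.mem_neighborFinset, mem_bipartiteBelow,
        G.adj_comm u z]
      tauto
    rw [h3, card_erase_of_mem (by simp [hx, hu.1.symm]), hm u hu.2]
  rw [sum_congr rfl h1, h, sum_congr rfl h2, sum_const, smul_eq_mul]

end Counting

/-- An adjacency-preserving and -reflecting injection between graphs of the same order is an
isomorphism. -/
lemma nonempty_iso_of_injective {V W : Type*} [Fintype V] [Fintype W] {G : SimpleGraph V}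
    {H : SimpleGraph W} (f : V → W) (hf : Function.Injective f)
    (hcard : Fintype.card V = Fintype.card W) (hadj : ∀ u w, H.Adj (f u) (f w) ↔ G.Adj u w) :
    Nonempty (G ≃g H) :=
  ⟨⟨Equiv.ofBijective f ((Fintype.bijective_iff_injective_and_card f).2 ⟨hf, hcard⟩),
    fun {u w} => hadj u w⟩⟩

namespace IsTightClique

variable {V : Type*} [Fintype V] [DecidableEq V] {G : SimpleGraph V} [DecidableRel G.Adj]
  {S : Finset V} {m s : ℕ}

lemma card_outer (h : IsTightClique G S m s) {x : V} (hx : x ∈ S) :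
    #(G.neighborFinset x \ S) + 1 = s := by
  have h1 := card_neighborFinset_sdiff_of_clique h.clique hx
  have h2 := h.degree x
  have h3 := h.card_eq
  omega

lemma card_outer_inter (h : IsTightClique G S m s) {x y : V} (hx : x ∈ S) (hy : y ∈ S)
    (hxy : x ≠ y) : #((G.neighborFinset x \ S) ∩ (G.neighborFinset y \ S)) + 1 = m := by
  have h1 := card_commonNeighbors_sdiff_of_clique h.clique hx hy hxy
  have h2 := h.common x y (h.clique x hx y hy hxy)
  have h3 := h.card_eq
  omega

lemma card_compl_mul (h : IsTightClique G S m s) : #Sᶜ * m = s * (s - 1) := by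
  have h0 := sum_card_bipartiteAbove_eq_sum_card_bipartiteBelow G.Adj (s := S) (t := Sᶜ)
  have h1 : ∀ x ∈ S, #(bipartiteAbove G.Adj Sᶜ x) = s - 1 := by
    intro x hx
    have h3 : bipartiteAbove G.Adj Sᶜ x = G.neighborFinset x \ S := by
      ext z
      simp [mem_bipartiteAbove, and_comm]
    have := h.card_outer hx
    rw [h3]
    omega
  have h2 : ∀ u ∈ Sᶜ, #(bipartiteBelow G.Adj S u) = m := by
    intro u hu
    rw [← h.nexus u (by simpa using hu)]
    congr 1
    ext z
    simp [mem_bipartiteBelow, G.adj_comm u z, and_comm]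
  rw [sum_congr rfl h1, sum_congr rfl h2, sum_const, sum_const, h.card_eq] at h0
  simpa using h0.symm

lemma outer_clique (h : IsTightClique G S m s) {x : V} (hx : x ∈ S) {u w : V}
    (hu : u ∉ S) (hw : w ∉ S) (hxu : G.Adj x u) (hxw : G.Adj x w) (huw : u ≠ w) :
    G.Adj u w := by
  have h1 := h.common x u hxu
  have h2 := card_sdiff_add_card_inter (G.neighborFinset x ∩ G.neighborFinset u) S
  have h3 : (G.neighborFinset x ∩ G.neighborFinset u) ∩ S = (G.neighborFinset u ∩ S).erase x := by
    ext z
    simp only [mem_inter, mem_erase, SimpleGraph.mem_neighborFinset]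
    exact ⟨fun hz => ⟨hz.1.1.ne', hz.1.2, hz.2⟩,
      fun hz => ⟨⟨h.clique x hx z hz.2.2 hz.1.symm, hz.2.1⟩, hz.2.2⟩⟩
  have h4 := card_erase_add_one (s := G.neighborFinset u ∩ S) (a := x) (by simp [hx, hxu.symm])
  have h5 := h.nexus u hu
  have h6 := h.card_outer hx
  have h7 := card_erase_add_one (s := G.neighborFinset x \ S) (a := u) (by simp [hu, hxu])
  have h8 : (G.neighborFinset x ∩ G.neighborFinset u) \ S ⊆ (G.neighborFinset x \ S).erase u := by
    intro z
    simp only [mem_inter, mem_erase, mem_sdiff, SimpleGraph.mem_neighborFinset]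
    exact fun hz => ⟨hz.1.2.ne', hz.1.1, hz.2⟩
  rw [h3] at h2
  have h9 := eq_of_subset_of_card_le h8 (by omega)
  have h10 : w ∈ (G.neighborFinset x \ S).erase u := by simp [hw, hxw, huw.symm]
  rw [← h9] at h10
  simp only [mem_inter, mem_sdiff, SimpleGraph.mem_neighborFinset] at h10
  exact h10.1.2

lemma adj_or_adj_of_adj (h : IsTightClique G S m s) {x y : V} (hx : x ∈ S) (hy : y ∈ S)
    (hxy : x ≠ y) {u w : V} (hu : u ∉ S) (hw : w ∉ S) (hxu : G.Adj x u) (hyu : G.Adj y u)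
    (huw : G.Adj u w) : G.Adj x w ∨ G.Adj y w := by
  have h1 : ((G.neighborFinset x \ S) ∪ (G.neighborFinset y \ S)).erase u ⊆
      G.neighborFinset u \ S := by
    intro z hz
    simp only [mem_union, mem_erase, mem_sdiff, SimpleGraph.mem_neighborFinset] at hz ⊢
    rcases hz with ⟨hzu, ⟨hz, hzS⟩ | ⟨hz, hzS⟩⟩
    · exact ⟨h.outer_clique hx hu hzS hxu hz hzu.symm, hzS⟩
    · exact ⟨h.outer_clique hy hu hzS hyu hz hzu.symm, hzS⟩
  have h2 := card_union_add_card_inter (G.neighborFinset x \ S) (G.neighborFinset y \ S)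
  have h3 := card_erase_add_one (s := (G.neighborFinset x \ S) ∪ (G.neighborFinset y \ S)) (a := u)
    (by simp [hu, hxu])
  have h4 := h.card_outer hx
  have h5 := h.card_outer hy
  have h6 := h.card_outer_inter hx hy hxy
  have h7 := card_sdiff_add_card_inter (G.neighborFinset u) S
  have h8 := h.nexus u hu
  have h9 := h.degree u
  have h10 := eq_of_subset_of_card_le h1 (by omega)
  have h11 : w ∈ G.neighborFinset u \ S := by simp [hw, huw]
  rw [← h10] at h11
  simp only [mem_union, mem_erase, mem_sdiff, SimpleGraph.mem_neighborFinset] at h11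
  tauto

lemma exists_not_mem (h : IsTightClique G S m s) : ∃ u, u ∉ S := by
  by_contra! hc
  have h1 : Sᶜ = ∅ := by ext z; simp [hc z]
  have h2 := h.card_compl_mul
  have := h.pos
  have := h.lt
  rw [h1, card_empty, zero_mul] at h2
  have : 0 < s * (s - 1) := Nat.mul_pos (by omega) (by omega)
  omega

/-! ### Nexus one: the square lattice graph -/

section One

lemma card_eq_mul_self (h : IsTightClique G S 1 s) : Fintype.card V = s * s := by
  have h1 := h.card_compl_mul
  have h2 := card_add_card_compl S
  obtain ⟨t, rfl⟩ : ∃ t, s = t + 1 := ⟨s - 1, by have := h.lt; omega⟩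
  rw [h.card_eq] at h2
  simp only [mul_one, Nat.add_sub_cancel] at h1
  rw [← h2, h1]
  ring

lemma insert_outer (h : IsTightClique G S 1 s) {x : V} (hx : x ∈ S) :
    IsTightClique G (insert x (G.neighborFinset x \ S)) 1 s := by
  set D := insert x (G.neighborFinset x \ S) with hD
  have hcl : ∀ a ∈ D, ∀ b ∈ D, a ≠ b → G.Adj a b := by
    intro a ha b hb hab
    simp only [hD, mem_insert, mem_sdiff, SimpleGraph.mem_neighborFinset] at ha hb
    rcases ha with rfl | ha
    · rcases hb with rfl | hb
      · exact absurd rfl hab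
      · exact hb.1
    · rcases hb with rfl | hb
      · exact ha.1.symm
      · exact h.outer_clique hx ha.2 hb.2 ha.1 hb.1 hab
  have hcard : #D = s := by
    rw [hD, card_insert_of_notMem (by simp), h.card_outer hx]
  have hdisj : ∀ a ∈ D, ∀ b ∈ D, a ≠ b →
      Disjoint (G.neighborFinset a \ D) (G.neighborFinset b \ D) := by
    intro a ha b hb hab
    have h1 := card_commonNeighbors_sdiff_of_clique hcl ha hb hab
    have h2 := h.common a b (hcl a ha b hb hab)
    rw [disjoint_iff_inter_eq_empty, ← card_eq_zero]
    omega
  have hout : ∀ a ∈ D, #(G.neighborFinset a \ D) = s - 1 := by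
    intro a ha
    have h1 := card_neighborFinset_sdiff_of_clique hcl ha
    have h2 := h.degree a
    omega
  have hunion : D.biUnion (fun a => G.neighborFinset a \ D) = Dᶜ := by
    apply eq_of_subset_of_card_le
    · intro z
      simp only [mem_biUnion, mem_sdiff, mem_compl]
      rintro ⟨_, _, _, hz⟩
      exact hz
    · rw [card_biUnion hdisj, sum_congr rfl hout, sum_const, hcard, smul_eq_mul,
        card_compl, hcard, h.card_eq_mul_self, Nat.mul_sub, mul_one]
  refine ⟨hcl, hcard, h.pos, h.lt, h.degree, h.common, fun u hu => ?_⟩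
  have hu' : u ∈ Dᶜ := mem_compl.2 hu
  rw [← hunion] at hu'
  simp only [mem_biUnion, mem_sdiff, SimpleGraph.mem_neighborFinset] at hu'
  obtain ⟨a, ha, hau, _⟩ := hu'
  rw [card_eq_one]
  refine ⟨a, ?_⟩
  ext b
  simp only [mem_inter, SimpleGraph.mem_neighborFinset, mem_singleton]
  refine ⟨fun hb => ?_, fun hb => hb ▸ ⟨hau.symm, ha⟩⟩
  by_contra hba
  refine notMem_empty u
    (disjoint_iff_inter_eq_empty.1 (hdisj b hb.2 a ha hba) ▸ mem_inter.2 ⟨?_, ?_⟩)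
  · simp [hu, hb.1.symm]
  · simp [hu, hau]

lemma exists_retraction (h : IsTightClique G S 1 s) : ∃ p : V → V, ∀ u, p u ∈ S ∧
    ∀ x ∈ S, p u = x ↔ u ∈ insert x (G.neighborFinset x \ S) := by
  suffices H : ∀ u, ∃ y, y ∈ S ∧ ∀ x ∈ S, y = x ↔ u ∈ insert x (G.neighborFinset x \ S) by
    choose p hp using H
    exact ⟨p, hp⟩
  intro u
  by_cases hu : u ∈ S
  · exact ⟨u, hu, fun x _ => by simp [hu]⟩
  · obtain ⟨y, hy⟩ := card_eq_one.1 (h.nexus u hu)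
    have hy' : ∀ x, x ∈ G.neighborFinset u ∩ S ↔ x = y := by simp [hy]
    simp only [mem_inter, SimpleGraph.mem_neighborFinset] at hy'
    refine ⟨y, ((hy' y).2 rfl).2, fun x hx => ?_⟩
    have : u ≠ x := fun hux => hu (hux ▸ hx)
    have h2 := hy' x
    simp only [mem_insert, this, mem_sdiff, SimpleGraph.mem_neighborFinset, hu, G.adj_comm x u]
    grind

theorem nonempty_iso_squareLatticeGraph (h : IsTightClique G S 1 s) :
    Nonempty (G ≃g squareLatticeGraph s) := by
  obtain ⟨x₀, hx₀⟩ : S.Nonempty := card_pos.1 (by have := h.lt; have := h.card_eq; omega)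
  have hC := h.insert_outer hx₀
  set C := insert x₀ (G.neighborFinset x₀ \ S) with hCdef
  obtain ⟨p, hp⟩ := h.exists_retraction
  obtain ⟨q, hq⟩ := hC.exists_retraction
  have hinj : ∀ u w, p u = p w → q u = q w → u = w := by
    intro u w hpu hqu
    by_contra huw
    by_cases hx : p u = x₀
    · have hu : u ∈ C := ((hp u).2 x₀ hx₀).1 hx
      have hw : w ∈ C := ((hp w).2 x₀ hx₀).1 (hpu ▸ hx)
      have hu' : q u = u := ((hq u).2 u hu).2 (mem_insert_self _ _)
      have hw' : q w = w := ((hq w).2 w hw).2 (mem_insert_self _ _)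
      exact huw (by rw [← hu', hqu, hw'])
    · have hD := h.insert_outer (hp u).1
      have huD := ((hp u).2 _ (hp u).1).1 rfl
      have hwD := ((hp w).2 _ (hp u).1).1 hpu.symm
      have hcD : q u ∉ insert (p u) (G.neighborFinset (p u) \ S) := by
        intro hc
        have h1 := ((hp (q u)).2 _ (hp u).1).2 hc
        have h2 := ((hp (q u)).2 _ hx₀).2 (hq u).1
        exact hx (h1 ▸ h2)
      have huc := ((hq u).2 _ (hq u).1).1 rfl
      have hwc := ((hq w).2 _ (hq u).1).1 hqu.symm
      have hau : G.Adj (q u) u := by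
        rcases mem_insert.1 huc with h1 | h1
        · exact absurd (h1 ▸ huD) hcD
        · simpa using (mem_sdiff.1 h1).1
      have haw : G.Adj (q u) w := by
        rcases mem_insert.1 hwc with h1 | h1
        · exact absurd (h1 ▸ hwD) hcD
        · simpa using (mem_sdiff.1 h1).1
      have h1 := hD.nexus _ hcD
      exact huw (card_le_one.1 h1.le u (mem_inter.2 ⟨by simpa using hau, huD⟩) w
        (mem_inter.2 ⟨by simpa using haw, hwD⟩))
  have hfib : ∀ u w, w ≠ u → p w = p u → G.Adj u w := fun u w hwu hpw =>
    (h.insert_outer (hp u).1).clique _ (((hp u).2 _ (hp u).1).1 rfl) _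
      (((hp w).2 _ (hp u).1).1 hpw) hwu.symm
  have hfibq : ∀ u w, w ≠ u → q w = q u → G.Adj u w := fun u w hwu hqw =>
    (hC.insert_outer (hq u).1).clique _ (((hq u).2 _ (hq u).1).1 rfl) _
      (((hq w).2 _ (hq u).1).1 hqw) hwu.symm
  have hadj : ∀ u w, G.Adj u w → p w = p u ∨ q w = q u := by
    intro u w huw
    set A := (insert (p u) (G.neighborFinset (p u) \ S)).erase u
    set B := (insert (q u) (G.neighborFinset (q u) \ C)).erase u
    have hA : #A + 1 = s := by
      rw [card_erase_add_one (((hp u).2 _ (hp u).1).1 rfl), (h.insert_outer (hp u).1).card_eq]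
    have hB : #B + 1 = s := by
      rw [card_erase_add_one (((hq u).2 _ (hq u).1).1 rfl), (hC.insert_outer (hq u).1).card_eq]
    have hA' : ∀ z ∈ A, z ≠ u ∧ p z = p u := fun z hz =>
      ⟨(mem_erase.1 hz).1, ((hp z).2 _ (hp u).1).2 (mem_erase.1 hz).2⟩
    have hB' : ∀ z ∈ B, z ≠ u ∧ q z = q u := fun z hz =>
      ⟨(mem_erase.1 hz).1, ((hq z).2 _ (hq u).1).2 (mem_erase.1 hz).2⟩
    have hAB : Disjoint A B := disjoint_left.2 fun z hzA hzB =>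
      (hA' z hzA).1 (hinj z u (hA' z hzA).2 (hB' z hzB).2)
    have hsub : A ∪ B ⊆ G.neighborFinset u := by
      intro z hz
      rw [SimpleGraph.mem_neighborFinset]
      rcases mem_union.1 hz with hz | hz
      · exact hfib u z (hA' z hz).1 (hA' z hz).2
      · exact hfibq u z (hB' z hz).1 (hB' z hz).2
    have h1 := card_union_of_disjoint hAB
    have h2 := h.degree u
    have h3 := eq_of_subset_of_card_le hsub (by omega)
    have h4 : w ∈ A ∪ B := by rw [h3]; simpa using huw
    rcases mem_union.1 h4 with hz | hz
    · exact Or.inl (hA' w hz).2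
    · exact Or.inr (hB' w hz).2
  let eS := S.equivFinOfCardEq h.card_eq
  let eC := C.equivFinOfCardEq hC.card_eq
  have e1 : ∀ u w, eS ⟨p u, (hp u).1⟩ = eS ⟨p w, (hp w).1⟩ ↔ p u = p w := by simp
  have e2 : ∀ u w, eC ⟨q u, (hq u).1⟩ = eC ⟨q w, (hq w).1⟩ ↔ q u = q w := by simp
  refine nonempty_iso_of_injective (fun u => (eS ⟨p u, (hp u).1⟩, eC ⟨q u, (hq u).1⟩)) ?_ ?_ ?_
  · intro u w huw
    simp only [Prod.mk.injEq, e1, e2] at huw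
    exact hinj u w huw.1 huw.2
  · simp [h.card_eq_mul_self]
  · intro u w
    simp only [squareLatticeGraph, SimpleGraph.fromRel_adj, ne_eq, Prod.mk.injEq, e1, e2]
    have := hinj u w
    have := hfib u w
    have := hfibq u w
    have := hadj u w
    have := G.ne_of_adj (a := u) (b := w)
    grind

end One

/-! ### Nexus two: the triangular graph -/

theorem nonempty_iso_triangularGraph (h : IsTightClique G S 2 s) :
    Nonempty (G ≃g triangularGraph (s + 1)) := by
  obtain ⟨ι, hι, hlast⟩ : ∃ ι : V → Fin (s + 1), Set.InjOn ι S ∧ ∀ x ∈ S, ι x ≠ Fin.last s := by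
    let e := S.equivFinOfCardEq h.card_eq
    refine ⟨fun x => if hx : x ∈ S then (e ⟨x, hx⟩).castSucc else Fin.last s, ?_, ?_⟩
    · intro x hx y hy hxy
      simp only [mem_coe] at hx hy
      simpa [hx, hy] using hxy
    · intro x hx
      simp only [hx, dif_pos]
      exact (Fin.castSucc_lt_last _).ne
  let B : V → Finset V := fun u => G.neighborFinset u ∩ S
  have hBS : ∀ u, B u ⊆ S := fun u => inter_subset_right
  let f : V → Finset (Fin (s + 1)) := fun u => if u ∈ S then {ι u, Fin.last s} else (B u).image ι
  have hBcard : ∀ u ∉ S, #(B u) = 2 := h.nexus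
  have hf : ∀ u, #(f u) = 2 := by
    intro u
    by_cases hu : u ∈ S
    · simp only [f, hu, if_true]
      exact card_pair (hlast u hu)
    · simp only [f, hu, if_false]
      rw [card_image_of_injOn (hι.mono (by exact_mod_cast hBS u)), hBcard u hu]
  have hlastmem : ∀ u, Fin.last s ∈ f u ↔ u ∈ S := by
    intro u
    by_cases hu : u ∈ S
    · simp [f, hu]
    · simp only [f, hu, if_false, iff_false, mem_image, not_exists, not_and]
      exact fun x hx => hlast x (hBS u hx)
  have himage : ∀ u x, u ∉ S → x ∈ S → (ι x ∈ f u ↔ G.Adj u x) := by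
    intro u x hu hx
    simp only [f, hu, if_false, mem_image]
    constructor
    · rintro ⟨y, hy, hyx⟩
      have : y = x := hι (hBS u hy) hx hyx
      subst this
      simpa [hx, B] using hy
    · exact fun hux => ⟨x, by simp [B, hux, hx], rfl⟩
  have hinj : Function.Injective f := by
    intro u w huw
    by_cases hu : u ∈ S
    · have hw : w ∈ S := by rw [← hlastmem, ← huw, hlastmem]; exact hu
      have h1 : ι u ∈ f w := by rw [← huw]; simp [f, hu]
      simp only [f, hw, if_true, mem_insert, mem_singleton, hlast u hu, or_false] at h1
      exact hι hu hw h1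
    · have hw : w ∉ S := by rwa [← hlastmem, ← huw, hlastmem]
      obtain ⟨x, y, hxy, hB⟩ := card_eq_two.1 (hBcard u hu)
      have hxB : x ∈ B u := by simp [hB]
      have hyB : y ∈ B u := by simp [hB]
      have hx := hBS u hxB
      have hy := hBS u hyB
      have hux : G.Adj u x := by simpa [B, hx] using hxB
      have huy : G.Adj u y := by simpa [B, hy] using hyB
      have hwx : G.Adj w x := by rw [← himage w x hw hx, ← huw, himage u x hu hx]; exact hux
      have hwy : G.Adj w y := by rw [← himage w y hw hy, ← huw, himage u y hu hy]; exact huy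
      have h1 := h.card_outer_inter hx hy hxy
      refine card_le_one.1 (Nat.succ_injective h1).le u ?_ w ?_
      · simp [hu, hux.symm, huy.symm]
      · simp [hw, hwx.symm, hwy.symm]
  have hone : ∀ u w, u ≠ w → (#(f u ∩ f w) = 1 ↔ (f u ∩ f w).Nonempty) := by
    intro u w huw
    rw [← card_pos]
    have h1 : #(f u ∩ f w) ≤ 2 := (card_le_card inter_subset_left).trans (hf u).le
    have h2 : #(f u ∩ f w) ≠ 2 := by
      intro h2
      have h3 := eq_of_subset_of_card_le (inter_subset_left : f u ∩ f w ⊆ f u) (by rw [hf, h2])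
      have h4 := eq_of_subset_of_card_le (inter_subset_right : f u ∩ f w ⊆ f w) (by rw [hf, h2])
      exact huw (hinj (h3.symm.trans h4))
    omega
  have hadj : ∀ u w, u ≠ w → ((f u ∩ f w).Nonempty ↔ G.Adj u w) := by
    have hmix : ∀ u w, u ∈ S → w ∉ S → ((f u ∩ f w).Nonempty ↔ G.Adj u w) := by
      intro u w hu hw
      rw [G.adj_comm, ← himage w u hw hu]
      constructor
      · rintro ⟨i, hi⟩
        rw [mem_inter] at hi
        have h1 : i = ι u ∨ i = Fin.last s := by simpa [f, hu] using hi.1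
        rcases h1 with rfl | rfl
        · exact hi.2
        · exact absurd ((hlastmem w).1 hi.2) hw
      · exact fun hi => ⟨ι u, mem_inter.2 ⟨by simp [f, hu], hi⟩⟩
    intro u w huw
    by_cases hu : u ∈ S <;> by_cases hw : w ∈ S
    · exact iff_of_true ⟨Fin.last s, mem_inter.2 ⟨(hlastmem u).2 hu, (hlastmem w).2 hw⟩⟩
        (h.clique u hu w hw huw)
    · exact hmix u w hu hw
    · rw [inter_comm, G.adj_comm]
      exact hmix w u hw hu
    · constructor
      · rintro ⟨i, hi⟩
        rw [mem_inter] at hi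
        obtain ⟨x, hxB, rfl⟩ : ∃ x ∈ B u, ι x = i := by simpa [f, hu] using hi.1
        have hx := hBS u hxB
        exact h.outer_clique hx hu hw ((himage u x hu hx).1 hi.1).symm
          ((himage w x hw hx).1 hi.2).symm huw
      · intro hadj
        obtain ⟨x, y, hxy, hB⟩ := card_eq_two.1 (hBcard u hu)
        have hxB : x ∈ B u := by simp [hB]
        have hyB : y ∈ B u := by simp [hB]
        have hx := hBS u hxB
        have hy := hBS u hyB
        have hux : G.Adj u x := by simpa [B, hx] using hxB
        have huy : G.Adj u y := by simpa [B, hy] using hyB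
        rcases h.adj_or_adj_of_adj hx hy hxy hu hw hux.symm huy.symm hadj with h1 | h1
        · exact ⟨ι x, mem_inter.2 ⟨(himage u x hu hx).2 hux, (himage w x hw hx).2 h1.symm⟩⟩
        · exact ⟨ι y, mem_inter.2 ⟨(himage u y hu hy).2 huy, (himage w y hw hy).2 h1.symm⟩⟩
  refine nonempty_iso_of_injective (fun u => ⟨f u, hf u⟩) ?_ ?_ ?_
  · exact fun u w huw => hinj (congrArg Subtype.val huw)
  · have h1 : Fintype.card {A : Finset (Fin (s + 1)) // #A = 2} = (s + 1).choose 2 := by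
      rw [Fintype.card_finset_len, Fintype.card_fin]
    have h2 := h.card_compl_mul
    have h3 := card_add_card_compl S
    rw [h.card_eq] at h3
    rw [h1, Nat.choose_two_right, Nat.add_sub_cancel]
    obtain ⟨t, rfl⟩ : ∃ t, s = t + 1 := ⟨s - 1, by have := h.lt; omega⟩
    rw [Nat.add_sub_cancel] at h2
    symm
    apply Nat.div_eq_of_eq_mul_left two_pos
    rw [← h3]
    linarith
  · intro u w
    by_cases huw : u = w
    · subst huw
      simp
    · have h1 : (⟨f u, hf u⟩ : {A : Finset (Fin (s + 1)) // #A = 2}) ≠ ⟨f w, hf w⟩ :=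
        fun he => huw (hinj (congrArg Subtype.val he))
      simp only [triangularGraph, SimpleGraph.fromRel_adj]
      rw [inter_comm (f w) (f u), or_self, and_iff_right h1, hone u w huw, hadj u w huw]

/-! ### Nexus at least three: the cocktail party graph -/

lemma add_one_eq_of_three_le (h : IsTightClique G S m s) (hm : 3 ≤ m) : m + 1 = s := by
  have hbig : s < 2 * m := by
    obtain ⟨u, hu⟩ := h.exists_not_mem
    obtain ⟨x, hx, y, hy, z, hz, hxy, hxz, hyz⟩ :=
      two_lt_card.1 (show 2 < #(G.neighborFinset u ∩ S) by rw [h.nexus u hu]; omega)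
    simp only [mem_inter, SimpleGraph.mem_neighborFinset] at hx hy hz
    have h1 : G.neighborFinset z \ S ⊆
        ((G.neighborFinset z \ S) ∩ (G.neighborFinset x \ S)) ∪
          ((G.neighborFinset z \ S) ∩ (G.neighborFinset y \ S)) := by
      intro w hw
      simp only [mem_union, mem_inter, mem_sdiff, SimpleGraph.mem_neighborFinset] at hw ⊢
      by_cases huw : u = w
      · subst huw
        exact Or.inl ⟨hw, hx.1.symm, hu⟩
      · have := h.adj_or_adj_of_adj hx.2 hy.2 hxy hu hw.2 hx.1.symm hy.1.symm
          (h.outer_clique hz.2 hu hw.2 hz.1.symm hw.1 huw)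
        tauto
    have h2 := (card_le_card h1).trans (card_union_le _ _)
    have h3 := h.card_outer hz.2
    have h4 := h.card_outer_inter hz.2 hx.2 hxz.symm
    have h5 := h.card_outer_inter hz.2 hy.2 hyz.symm
    omega
  have hcl : ∀ u ∉ S, ∀ w ∉ S, u ≠ w → G.Adj u w := by
    intro u hu w hw huw
    have h1 := card_union_add_card_inter (G.neighborFinset u ∩ S) (G.neighborFinset w ∩ S)
    have h2 : #((G.neighborFinset u ∩ S) ∪ (G.neighborFinset w ∩ S)) ≤ #S :=
      card_le_card (union_subset inter_subset_right inter_subset_right)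
    rw [h.nexus u hu, h.nexus w hw] at h1
    rw [h.card_eq] at h2
    obtain ⟨x, hx⟩ := card_pos.1
      (show 0 < #((G.neighborFinset u ∩ S) ∩ (G.neighborFinset w ∩ S)) by omega)
    simp only [mem_inter, SimpleGraph.mem_neighborFinset] at hx
    exact h.outer_clique hx.1.2 hu hw hx.1.1.symm hx.2.1.symm huw
  obtain ⟨u, hu⟩ := h.exists_not_mem
  have h1 : G.neighborFinset u \ S = Sᶜ.erase u := by
    ext w
    simp only [mem_sdiff, mem_erase, mem_compl, SimpleGraph.mem_neighborFinset]
    exact ⟨fun hw => ⟨hw.1.ne', hw.2⟩, fun hw => ⟨hcl u hu w hw.2 hw.1.symm, hw.2⟩⟩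
  have h2 := card_sdiff_add_card_inter (G.neighborFinset u) S
  have h3 := card_erase_add_one (mem_compl.2 hu)
  have h4 := h.nexus u hu
  have h5 := h.degree u
  have h6 := h.card_compl_mul
  have h7 := h.lt
  rw [h1] at h2
  have h8 : #Sᶜ + m + 1 = 2 * s := by omega
  obtain ⟨t, rfl⟩ : ∃ t, s = m + 1 + t := ⟨s - m - 1, by omega⟩
  have h9 : #Sᶜ = m + 1 + 2 * t := by omega
  rw [h9, show m + 1 + t - 1 = m + t by omega] at h6
  have h10 : t * (t + 1) = 0 := by nlinarith
  rcases Nat.mul_eq_zero.1 h10 with h11 | h11 <;> omega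

theorem nonempty_iso_completeMultipartiteGraph (h : IsTightClique G S m s) (hm : m + 1 = s) :
    Nonempty (G ≃g SimpleGraph.completeMultipartiteGraph (fun _ : Fin s => Fin 2)) := by
  have hcompl : #Sᶜ = s := by
    have h1 := h.card_compl_mul
    subst hm
    rw [Nat.add_sub_cancel] at h1
    exact Nat.eq_of_mul_eq_mul_right h.pos h1
  have hV : Fintype.card V = 2 * s := by
    have := card_add_card_compl S
    have := h.card_eq
    omega
  have hnon : ∀ x, ∃ y, y ≠ x ∧ ∀ z, z ≠ x → (¬ G.Adj x z ↔ z = y) := by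
    intro x
    have h1 : #((univ.erase x) \ G.neighborFinset x) = 1 := by
      rw [card_sdiff_of_subset, card_erase_of_mem (mem_univ x), card_univ]
      · have := h.degree x
        have := h.lt
        omega
      · intro z hz
        rw [SimpleGraph.mem_neighborFinset] at hz
        simp [hz.ne']
    obtain ⟨y, hy⟩ := card_eq_one.1 h1
    have hy' : ∀ z, z ∈ (univ.erase x) \ G.neighborFinset x ↔ z = y := by simp [hy]
    simp only [mem_sdiff, mem_erase, mem_univ, and_true, SimpleGraph.mem_neighborFinset] at hy'
    exact ⟨y, ((hy' y).2 rfl).1, fun z hz => by rw [← hy', and_iff_right hz]⟩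
  choose g hg hgadj using hnon
  have hgS : ∀ x ∈ S, g x ∉ S := fun x hx hgx =>
    ((hgadj x (g x) (hg x)).2 rfl) (h.clique x hx _ hgx (hg x).symm)
  have hgg : ∀ x, g (g x) = x := by
    intro x
    refine ((hgadj (g x) x (hg x).symm).1 fun hadj => ?_).symm
    exact (hgadj x (g x) (hg x)).2 rfl hadj.symm
  let e := S.equivFinOfCardEq h.card_eq
  let c : V → S := fun u => if hu : u ∈ S then ⟨u, hu⟩ else
    if hgu : g u ∈ S then ⟨g u, hgu⟩ else ⟨_, (e.symm ⟨0, by have := h.lt; omega⟩).2⟩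
  have hcover : ∀ u ∉ S, g u ∈ S := by
    have h1 : S.image g = Sᶜ := by
      apply eq_of_subset_of_card_le
      · intro z hz
        obtain ⟨x, hx, rfl⟩ := mem_image.1 hz
        exact mem_compl.2 (hgS x hx)
      · rw [card_image_of_injective _ (Function.LeftInverse.injective hgg), hcompl, h.card_eq]
    intro u hu
    have h2 : u ∈ S.image g := h1 ▸ mem_compl.2 hu
    obtain ⟨x, hx, rfl⟩ := mem_image.1 h2
    rwa [hgg]
  have hc : ∀ u, (c u : V) = if u ∈ S then u else g u := by
    intro u
    by_cases hu : u ∈ S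
    · simp [c, hu]
    · simp [c, hu, hcover u hu]
  have hcc : ∀ u w, e (c u) = e (c w) ↔ w = u ∨ w = g u := by
    intro u w
    rw [e.injective.eq_iff, Subtype.ext_iff, hc, hc]
    have := hgS u
    have := hgS w
    have := hcover u
    have := hcover w
    have := hgg u
    have := hgg w
    grind
  refine nonempty_iso_of_injective
    (W := Σ _ : Fin s, Fin 2) (fun u => ⟨e (c u), if u ∈ S then 0 else 1⟩) ?_ ?_ ?_
  · intro u w huw
    simp only [Sigma.mk.injEq, heq_eq_eq, hcc] at huw
    rcases huw with ⟨rfl | rfl, h2⟩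
    · rfl
    · exfalso
      by_cases hu : u ∈ S
      · simp [hu, hgS u hu] at h2
      · simp [hu, hcover u hu] at h2
  · simp [hV, mul_comm]
  · intro u w
    simp only [SimpleGraph.completeMultipartiteGraph, SimpleGraph.comap_adj, SimpleGraph.top_adj,
      ne_eq, hcc]
    by_cases hwu : w = u
    · simp [hwu]
    · have := hgadj u w hwu
      tauto

end IsTightClique

/-- The parameters of a Neumaier graph with `k - λ - s + m - 1 = 0`. -/
lemma isTightClique_of_equality {V : Type*} [Fintype V] [DecidableEq V] {G : SimpleGraph V}
    [DecidableRel G.Adj] {S : Finset V} {k lam m s : ℕ} (htop : G ≠ ⊤) (hs : 2 ≤ s)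
    (hdeg : ∀ u, #(G.neighborFinset u) = k)
    (hlam : ∀ u w, G.Adj u w → #(G.neighborFinset u ∩ G.neighborFinset w) = lam)
    (hS : ∀ x ∈ S, ∀ y ∈ S, x ≠ y → G.Adj x y) (hcard : #S = s) (hm : 0 < m)
    (hnexus : ∀ u ∉ S, #(G.neighborFinset u ∩ S) = m)
    (heq : (k : ℤ) - lam - s + m - 1 = 0) : IsTightClique G S m s := by
  obtain ⟨u, hu⟩ : ∃ u, u ∉ S := by
    by_contra! hc
    refine htop ?_
    ext a b
    exact ⟨fun hab => hab.ne, fun hab => hS a (hc a) b (hc b) hab⟩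
  obtain ⟨x, hx⟩ : S.Nonempty := card_pos.1 (by omega)
  have hle : m ≤ s := by
    rw [← hnexus u hu, ← hcard]
    exact card_le_card inter_subset_right
  have hlt : m < s := by
    refine lt_of_le_of_ne hle fun hms => htop ?_
    have hxall : ∀ w, w ≠ x → G.Adj x w := by
      intro w hwx
      by_cases hw : w ∈ S
      · exact hS x hx w hw hwx.symm
      · have h1 := eq_of_subset_of_card_le
          (inter_subset_right : G.neighborFinset w ∩ S ⊆ S) (by rw [hnexus w hw, hcard, hms])
        have h2 : x ∈ G.neighborFinset w ∩ S := h1.symm ▸ hx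
        simp only [mem_inter, SimpleGraph.mem_neighborFinset] at h2
        exact h2.1.symm
    have hk : k = #(univ : Finset V) - 1 := by
      rw [← hdeg x, ← card_erase_of_mem (mem_univ x)]
      congr 1
      ext w
      simp only [SimpleGraph.mem_neighborFinset, mem_erase, mem_univ, and_true]
      exact ⟨fun hw => hw.ne', hxall w⟩
    ext a b
    refine ⟨fun hab => hab.ne, fun hab => ?_⟩
    have h1 : G.neighborFinset a ⊆ univ.erase a := by
      intro z hz
      rw [SimpleGraph.mem_neighborFinset] at hz
      simp [hz.ne']
    have h2 := eq_of_subset_of_card_le h1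
      (by rw [hdeg, card_erase_of_mem (mem_univ a), hk])
    have h3 : b ∈ univ.erase a := by simpa using (Ne.symm hab)
    rw [← h2] at h3
    simpa using h3
  have hout := card_neighborFinset_sdiff_of_clique hS hx
  have hcount := sum_card_commonNeighbors_sdiff hx hnexus
  have hterm : ∀ y ∈ S.erase x, #((G.neighborFinset x \ S) ∩ (G.neighborFinset y \ S)) =
      lam + 2 - s := by
    intro y hy
    rw [mem_erase] at hy
    have h1 := card_commonNeighbors_sdiff_of_clique hS hx hy.2 hy.1.symm
    rw [hlam x y (hS x hx y hy.2 hy.1.symm)] at h1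
    omega
  have hlam2 : s ≤ lam + 2 := by
    obtain ⟨y, hy⟩ := card_pos.1 (show 0 < #(S.erase x) by rw [card_erase_of_mem hx]; omega)
    rw [mem_erase] at hy
    have h1 := card_commonNeighbors_sdiff_of_clique hS hx hy.2 hy.1.symm
    rw [hlam x y (hS x hx y hy.2 hy.1.symm)] at h1
    omega
  rw [sum_congr rfl hterm, sum_const, card_erase_of_mem hx, hcard, smul_eq_mul] at hcount
  rw [hdeg, hcard] at hout
  have hb : #(G.neighborFinset x \ S) = s - 1 := by
    set b := #(G.neighborFinset x \ S)
    zify [hlam2, hm, show 1 ≤ s by omega] at hcount hout ⊢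
    have h1 : ((s : ℤ) - m) * (b - (s - 1)) = 0 := by
      have h2 : (lam : ℤ) = b + m - 2 := by linarith
      rw [h2] at hcount
      linear_combination hcount
    rcases mul_eq_zero.1 h1 with h2 | h2 <;> omega
  refine ⟨hS, hcard, hm, hlt, fun a => ?_, fun a b hab => ?_, hnexus⟩
  · rw [hdeg]
    omega
  · rw [hlam a b hab]
    omega

/-- If `Γ` is a Neumaier graph with parameters `(v, k, λ; m, s)` and
`k − λ − s + m − 1 = 0`, then `Γ` is isomorphic to the square lattice graph `L₂(s)`,
or to the triangular graph `T(s+1)` with `s ≥ 3`, or to the complete multipartite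
graph `K_{s×2}`. -/
theorem neumaier_equality_classification {V : Type*} [Fintype V] (G : SimpleGraph V)
    (v k lam m s : ℕ) (h : IsNeumaier G v k lam m s)
    (heq : (k : ℤ) - lam - s + m - 1 = 0) :
    Nonempty (G ≃g squareLatticeGraph s) ∨
      (3 ≤ s ∧ Nonempty (G ≃g triangularGraph (s + 1))) ∨
      Nonempty (G ≃g SimpleGraph.completeMultipartiteGraph (fun _ : Fin s => Fin 2)) := by
  classical
  obtain ⟨⟨-, -, hdeg, hlam⟩, htop, hs, S, hS, hcard, hm, hnexus⟩ := h
  have hT : IsTightClique G S m s := by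
    refine isTightClique_of_equality htop hs (fun u => ?_) (fun u w huw => ?_)
      (fun x hx y hy hxy => hS hx hy hxy) hcard hm (fun u hu => ?_) heq
    · rw [← hdeg u, ← Set.ncard_coe_finset, SimpleGraph.coe_neighborFinset]
    · rw [← hlam u w huw, ← Set.ncard_coe_finset, coe_inter, SimpleGraph.coe_neighborFinset,
        SimpleGraph.coe_neighborFinset]
      rfl
    · rw [← hnexus u hu, ← Set.ncard_coe_finset, coe_inter, SimpleGraph.coe_neighborFinset]
  have hlt := hT.lt
  obtain rfl | rfl | h3 : m = 1 ∨ m = 2 ∨ 3 ≤ m := by omega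
  · exact Or.inl hT.nonempty_iso_squareLatticeGraph
  · exact Or.inr (Or.inl ⟨hlt, hT.nonempty_iso_triangularGraph⟩)
  · exact Or.inr (Or.inr
      (hT.nonempty_iso_completeMultipartiteGraph (hT.add_one_eq_of_three_le h3)))
end

section
/- Let Γ be a Neumaier graph with parameters (v, k, λ; m, s) such that k − λ − s + m − 1 = 0 and m = 1. Then Γ is isomorphic to the square lattice graph L₂(s). -/
open Finset in
/-- A 1-regular clique of size `r + 2` in a `(2 * r + 2)`-regular graph in which adjacent vertices
have `r` common neighbours induces a projection of the graph onto the clique, whose fibres are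
cliques of size `r + 2` such that no vertex outside a fibre has two neighbours in it. -/
lemma SimpleGraph.exists_projection_of_regularClique {V : Type*} [Fintype V] [DecidableEq V]
    {G : SimpleGraph V} [DecidableRel G.Adj] {r : ℕ}
    (hk : ∀ u, #{z | G.Adj u z} = 2 * r + 2)
    (hl : ∀ u w, G.Adj u w → #{z | G.Adj u z ∧ G.Adj w z} = r)
    {S : Finset V} (hS : G.IsClique S) (hc : #S = r + 2)
    (hreg : ∀ u ∉ S, ∃! x, x ∈ S ∧ G.Adj u x) :
    ∃ p : V → V, (∀ u, p u ∈ S) ∧ (∀ u ∈ S, p u = u) ∧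
      (∀ u w, p u = p w → u ≠ w → G.Adj u w) ∧
      (∀ x ∈ S, #{u | p u = x} = r + 2) ∧
      (∀ u w z, u ≠ w → p u = p w → G.Adj u z → G.Adj w z → p z = p u) := by
  have hex : ∀ u, ∃ x ∈ S, (u ∈ S → x = u) ∧ (u ∉ S → G.Adj u x) ∧
      ∀ y ∈ S, u ∉ S → G.Adj u y → y = x := by
    intro u
    by_cases hu : u ∈ S
    · exact ⟨u, hu, by simp [hu]⟩
    · obtain ⟨x, ⟨hx, hux⟩, huniq⟩ := hreg u hu
      exact ⟨x, hx, by simp [hu], fun _ => hux, fun y hy _ h => huniq y ⟨hy, h⟩⟩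
  choose p hpS hpfix hpadj hpuniq using hex
  have hout : ∀ x ∈ S, #{z | G.Adj x z ∧ z ∉ S} = r + 1 := by
    intro x hx
    have h1 : ({z | G.Adj x z} : Finset V) = S.erase x ∪ ({z | G.Adj x z ∧ z ∉ S} : Finset V) := by
      ext z
      simp only [mem_filter, mem_univ, true_and, mem_union, mem_erase]
      constructor
      · intro h
        by_cases hz : z ∈ S
        · exact Or.inl ⟨h.ne', hz⟩
        · exact Or.inr ⟨h, hz⟩
      · rintro (⟨hne, hz⟩ | h)
        · exact hS hx hz hne.symm
        · exact h.1
    have h2 : Disjoint (S.erase x) ({z | G.Adj x z ∧ z ∉ S} : Finset V) := by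
      rw [Finset.disjoint_left]
      intro z hz hz'
      exact (mem_filter.1 hz').2.2 (mem_of_mem_erase hz)
    have h3 := hk x
    rw [h1, card_union_of_disjoint h2, card_erase_of_mem hx] at h3
    omega
  have hfib : ∀ x ∈ S, ({u | p u = x} : Finset V) =
      insert x ({z | G.Adj x z ∧ z ∉ S} : Finset V) := by
    intro x hx
    ext z
    simp only [mem_filter, mem_univ, true_and, mem_insert]
    constructor
    · rintro rfl
      by_cases hz : z ∈ S
      · exact Or.inl (hpfix z hz).symm
      · exact Or.inr ⟨(hpadj z hz).symm, hz⟩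
    · rintro (rfl | ⟨h, hz⟩)
      · exact hpfix z hx
      · exact (hpuniq z x hx hz h.symm).symm
  have hcard : ∀ x ∈ S, #{u | p u = x} = r + 2 := by
    intro x hx
    rw [hfib x hx, card_insert_of_notMem (by simp), hout x hx]
  have hcl : ∀ u w, p u = p w → u ≠ w → G.Adj u w := by
    intro u w huw hne
    by_cases hu : u ∈ S
    · have hw : w ∉ S := fun hw => hne (by rw [← hpfix u hu, huw, hpfix w hw])
      have := hpadj w hw
      rw [← huw, hpfix u hu] at this
      exact this.symm
    by_cases hw : w ∈ S
    · have := hpadj u hu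
      rwa [huw, hpfix w hw] at this
    have hxu := (hpadj u hu).symm
    have hsub : ({z | G.Adj (p u) z ∧ G.Adj u z} : Finset V) ⊆
        ({z | G.Adj (p u) z ∧ z ∉ S} : Finset V).erase u := by
      intro z hz
      simp only [mem_filter, mem_univ, true_and, mem_erase] at hz ⊢
      refine ⟨hz.2.ne', hz.1, fun hzS => hz.1.ne' (hpuniq u z hzS hu hz.2)⟩
    have heq := eq_of_subset_of_card_le hsub (by
      rw [hl _ _ hxu, card_erase_of_mem (by simp [hxu, hu]), hout _ (hpS u)]; omega)
    have hwm : w ∈ ({z | G.Adj (p u) z ∧ z ∉ S} : Finset V).erase u := by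
      simp only [mem_filter, mem_univ, true_and, mem_erase]
      exact ⟨hne.symm, huw ▸ (hpadj w hw).symm, hw⟩
    rw [← heq] at hwm
    exact (mem_filter.1 hwm).2.2
  refine ⟨p, hpS, hpfix, hcl, hcard, ?_⟩
  intro u w z hne huw huz hwz
  have hsub : (({y | p y = p u} : Finset V).erase u).erase w ⊆
      ({y | G.Adj u y ∧ G.Adj w y} : Finset V) := by
    intro y hy
    simp only [mem_filter, mem_univ, true_and, mem_erase] at hy ⊢
    exact ⟨hcl u y hy.2.2.symm hy.2.1.symm, hcl w y (huw.symm.trans hy.2.2.symm) hy.1.symm⟩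
  have heq := eq_of_subset_of_card_le hsub (by
    rw [hl _ _ (hcl u w huw hne), card_erase_of_mem (by simp [hne.symm, huw]),
      card_erase_of_mem (by simp), hcard _ (hpS u)]; omega)
  have hz : z ∈ ({y | G.Adj u y ∧ G.Adj w y} : Finset V) := by simp [huz, hwz]
  rw [← heq] at hz
  simp only [mem_filter, mem_univ, true_and, mem_erase] at hz
  exact hz.2.2

open Finset in
/-- If `p` projects a `(2 * r + 2)`-regular graph onto a set of size `r + 2` with fibres that are
cliques of size `r + 2`, and no vertex outside a fibre has two neighbours in it, then every vertex
outside a fibre has exactly one neighbour in it. -/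
lemma SimpleGraph.existsUnique_adj_fiber {V : Type*} [Fintype V] [DecidableEq V]
    {G : SimpleGraph V} [DecidableRel G.Adj] {r : ℕ}
    (hk : ∀ u, #{z | G.Adj u z} = 2 * r + 2) {S : Finset V} (hc : #S = r + 2)
    {p : V → V} (hpS : ∀ u, p u ∈ S)
    (hcl : ∀ u w, p u = p w → u ≠ w → G.Adj u w)
    (hcard : ∀ x ∈ S, #{u | p u = x} = r + 2)
    (hclosed : ∀ u w z, u ≠ w → p u = p w → G.Adj u z → G.Adj w z → p z = p u)
    {x : V} (hx : x ∈ S) {u : V} (hu : p u ≠ x) :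
    ∃! y, p y = x ∧ G.Adj u y := by
  have h1 : ({z | G.Adj u z} : Finset V) =
      ({z | p z = p u} : Finset V).erase u ∪ ({z | G.Adj u z ∧ p z ≠ p u} : Finset V) := by
    ext z
    simp only [mem_filter, mem_univ, true_and, mem_union, mem_erase]
    constructor
    · intro h
      by_cases hz : p z = p u
      · exact Or.inl ⟨h.ne', hz⟩
      · exact Or.inr ⟨h, hz⟩
    · rintro (⟨hne, hz⟩ | h)
      · exact hcl u z hz.symm hne.symm
      · exact h.1
  have h2 : Disjoint (({z | p z = p u} : Finset V).erase u)
      ({z | G.Adj u z ∧ p z ≠ p u} : Finset V) := by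
    rw [Finset.disjoint_left]
    intro z hz hz'
    exact (mem_filter.1 hz').2.2 (mem_filter.1 (mem_of_mem_erase hz)).2
  have h3 := hk u
  rw [h1, card_union_of_disjoint h2, card_erase_of_mem (by simp), hcard _ (hpS u)] at h3
  have hinj : Set.InjOn p ({z | G.Adj u z ∧ p z ≠ p u} : Finset V) := by
    intro a ha b hb hab
    simp only [coe_filter, mem_univ, true_and, Set.mem_ofPred_eq] at ha hb
    by_contra hne
    exact ha.2 (hclosed a b u hne hab ha.1.symm hb.1.symm).symm
  have himg : ({z | G.Adj u z ∧ p z ≠ p u} : Finset V).image p = S.erase (p u) := by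
    apply eq_of_subset_of_card_le
    · intro y hy
      obtain ⟨z, hz, rfl⟩ := mem_image.1 hy
      exact mem_erase.2 ⟨(mem_filter.1 hz).2.2, hpS z⟩
    · rw [card_image_of_injOn hinj, card_erase_of_mem (hpS u)]
      omega
  have hxm : x ∈ S.erase (p u) := mem_erase.2 ⟨hu.symm, hx⟩
  rw [← himg] at hxm
  obtain ⟨y, hy, hyx⟩ := mem_image.1 hxm
  refine ⟨y, ⟨hyx, (mem_filter.1 hy).2.1⟩, ?_⟩
  rintro z ⟨hz, huz⟩
  by_contra hne
  exact hu ((hclosed z y u hne (hz.trans hyx.symm) huz.symm (mem_filter.1 hy).2.1.symm).trans hz)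

open Finset in
/-- A `(2 * r + 2)`-regular graph in which adjacent vertices have `r` common neighbours and which
contains a 1-regular clique of size `r + 2` is a square lattice graph. -/
lemma SimpleGraph.nonempty_iso_squareLatticeGraph {V : Type*} [Fintype V] [DecidableEq V]
    {G : SimpleGraph V} [DecidableRel G.Adj] {r : ℕ}
    (hk : ∀ u, #{z | G.Adj u z} = 2 * r + 2)
    (hl : ∀ u w, G.Adj u w → #{z | G.Adj u z ∧ G.Adj w z} = r)
    {S : Finset V} (hS : G.IsClique S) (hc : #S = r + 2)
    (hreg : ∀ u ∉ S, ∃! x, x ∈ S ∧ G.Adj u x) :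
    Nonempty (G ≃g squareLatticeGraph (r + 2)) := by
  obtain ⟨p, hpS, hpfix, hpcl, hpcard, hpclosed⟩ :=
    SimpleGraph.exists_projection_of_regularClique hk hl hS hc hreg
  obtain ⟨x₀, hx₀⟩ : S.Nonempty := card_pos.1 (by omega)
  obtain ⟨T, hT⟩ : ∃ T : Finset V, T = ({u | p u = x₀} : Finset V) := ⟨_, rfl⟩
  have hmT : ∀ z, z ∈ T ↔ p z = x₀ := by simp [hT]
  have hTc : #T = r + 2 := hT ▸ hpcard x₀ hx₀
  have hTcl : G.IsClique T := fun a ha b hb hne =>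
    hpcl a b (((hmT a).1 ha).trans ((hmT b).1 hb).symm) hne
  have hTreg : ∀ u ∉ T, ∃! x, x ∈ T ∧ G.Adj u x := by
    intro u hu
    simp only [hmT] at hu ⊢
    exact SimpleGraph.existsUnique_adj_fiber hk hc hpS hpcl hpcard hpclosed hx₀ hu
  obtain ⟨q, hqT, hqfix, hqcl, hqcard, -⟩ :=
    SimpleGraph.exists_projection_of_regularClique hk hl hTcl hTc hTreg
  have hqadj : ∀ u, q u ≠ u → G.Adj u (q u) := fun u hu =>
    hqcl u (q u) (hqfix _ (hqT u)).symm hu.symm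
  have hinj : ∀ u w, p u = p w → q u = q w → u = w := by
    intro u w hp hq
    by_contra hne
    by_cases hu : u ∈ T
    · have hw : w ∈ T := (hmT w).2 (hp ▸ (hmT u).1 hu)
      exact hne (by rw [← hqfix u hu, hq, hqfix w hw])
    · have hw : w ∉ T := fun hw => hu ((hmT u).2 (hp ▸ (hmT w).1 hw))
      have h1 := hqadj u fun h => hu (h ▸ hqT u)
      have h2 := hqadj w fun h => hw (h ▸ hqT w)
      have := hpclosed u w (q u) hne hp h1 (hq ▸ h2)
      exact hu ((hmT u).2 (this ▸ (hmT _).1 (hqT u)))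
  have hadj : ∀ u w, G.Adj u w → p u = p w ∨ q u = q w := by
    intro u w huw
    have hsub : ({z | p z = p u} : Finset V).erase u ∪ ({z | q z = q u} : Finset V).erase u ⊆
        ({z | G.Adj u z} : Finset V) := by
      intro z hz
      simp only [mem_filter, mem_univ, true_and, mem_union, mem_erase] at hz ⊢
      rcases hz with ⟨hne, h⟩ | ⟨hne, h⟩
      · exact hpcl u z h.symm hne.symm
      · exact hqcl u z h.symm hne.symm
    have hdisj : Disjoint (({z | p z = p u} : Finset V).erase u)
        (({z | q z = q u} : Finset V).erase u) := by
      rw [Finset.disjoint_left]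
      intro z hz hz'
      simp only [mem_filter, mem_univ, true_and, mem_erase] at hz hz'
      exact hz.1 (hinj z u hz.2 hz'.2)
    have heq := eq_of_subset_of_card_le hsub (by
      rw [hk, card_union_of_disjoint hdisj, card_erase_of_mem (by simp),
        card_erase_of_mem (by simp), hpcard _ (hpS u), hqcard _ (hqT u)]; omega)
    have hw : w ∈ ({z | G.Adj u z} : Finset V) := by simp [huw]
    rw [← heq] at hw
    simp only [mem_filter, mem_univ, true_and, mem_union, mem_erase] at hw
    exact hw.imp (fun h => h.2.symm) (fun h => h.2.symm)
  have hV : Fintype.card V = (r + 2) * (r + 2) := by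
    rw [← card_univ, card_eq_sum_card_fiberwise (f := p) (t := S) (fun u _ => hpS u),
      sum_congr rfl hpcard, sum_const, hc, smul_eq_mul]
  let eS := S.equivFinOfCardEq hc
  let eT := T.equivFinOfCardEq hTc
  let f : V → Fin (r + 2) × Fin (r + 2) := fun u => (eS ⟨p u, hpS u⟩, eT ⟨q u, hqT u⟩)
  have hf₁ : ∀ u w, (f u).1 = (f w).1 ↔ p u = p w := fun u w => by simp [f]
  have hf₂ : ∀ u w, (f u).2 = (f w).2 ↔ q u = q w := fun u w => by simp [f]
  have hf : Function.Bijective f := by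
    rw [Fintype.bijective_iff_injective_and_card]
    refine ⟨fun u w h => hinj u w ((hf₁ u w).1 (by rw [h])) ((hf₂ u w).1 (by rw [h])), ?_⟩
    simp [hV]
  refine ⟨⟨Equiv.ofBijective f hf, ?_⟩⟩
  intro u w
  simp only [Equiv.ofBijective_apply, squareLatticeGraph, SimpleGraph.fromRel_adj, ne_eq, hf₁, hf₂,
    hf.injective.eq_iff]
  constructor
  · rintro ⟨hne, (h | h) | (h | h)⟩
    · exact hpcl u w h.1 hne
    · exact hqcl u w h.2 hne
    · exact hpcl u w h.1.symm hne
    · exact hqcl u w h.2.symm hne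
  · intro h
    refine ⟨h.ne, Or.inl ?_⟩
    rcases hadj u w h with h' | h'
    · exact Or.inl ⟨h', fun h'' => h.ne (hinj u w h' h'')⟩
    · exact Or.inr ⟨fun h'' => h.ne (hinj u w h'' h'), h'⟩

/-- If `Γ` is a Neumaier graph with parameters `(v, k, λ; m, s)`,
`k − λ − s + m − 1 = 0` and `m = 1`, then `Γ` is isomorphic to the square lattice
graph `L₂(s)`. -/
theorem neumaier_equality_m_one {V : Type*} [Fintype V] (G : SimpleGraph V)
    (v k lam m s : ℕ) (h : IsNeumaier G v k lam m s)
    (heq : (k : ℤ) - lam - s + m - 1 = 0) (hm : m = 1) :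
    Nonempty (G ≃g squareLatticeGraph s) := by
  classical
  obtain ⟨⟨-, -, hk, hl⟩, -, hs, S, hS, rfl, -, hreg⟩ := h
  subst hm
  have hk' : ∀ u, ({z | G.Adj u z} : Finset V).card = k := fun u => by
    rw [← hk u, ← Set.ncard_coe_finset]
    congr 1
    ext z
    simp
  have hl' : ∀ u w, G.Adj u w → ({z | G.Adj u z ∧ G.Adj w z} : Finset V).card = lam := fun u w h => by
    rw [← hl u w h, ← Set.ncard_coe_finset]
    congr 1
    ext z
    simp [SimpleGraph.mem_commonNeighbors]
  have hreg' : ∀ u ∉ S, ∃! x, x ∈ S ∧ G.Adj u x := by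
    intro u hu
    obtain ⟨x, hx⟩ := Set.ncard_eq_one.1 (hreg u hu)
    have hmem : ∀ y, (G.Adj u y ∧ y ∈ S) ↔ y = x := fun y => by
      simpa using Set.ext_iff.1 hx y
    exact ⟨x, ((hmem x).2 rfl).symm, fun y hy => (hmem y).1 hy.symm⟩
  have hcard : S.card = lam + 2 := by
    obtain ⟨x, hx, y, hy, hne⟩ := Finset.one_lt_card.1 (show 1 < S.card by omega)
    have hcommon : ({z | G.Adj x z ∧ G.Adj y z} : Finset V) = (S.erase x).erase y := by
      ext z
      simp only [Finset.mem_filter, Finset.mem_univ, true_and, Finset.mem_erase]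
      constructor
      · rintro ⟨hxz, hyz⟩
        refine ⟨hyz.ne', hxz.ne', ?_⟩
        by_contra hz
        exact hne ((hreg' z hz).unique ⟨hx, hxz.symm⟩ ⟨hy, hyz.symm⟩)
      · rintro ⟨hzy, hzx, hz⟩
        exact ⟨hS hx hz hzx.symm, hS hy hz hzy.symm⟩
    have h := hl' x y (hS hx hy hne)
    rw [hcommon, Finset.card_erase_of_mem (by simp [hy, hne.symm]), Finset.card_erase_of_mem hx] at h
    omega
  have hk2 : k = 2 * lam + 2 := by
    push_cast at heq
    omega
  rw [hcard]
  exact SimpleGraph.nonempty_iso_squareLatticeGraph (fun u => (hk' u).trans hk2) hl' hS hcard hreg'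
end

section
/- Let Γ be a Neumaier graph with parameters (v, k, λ; m, s) such that k − λ − s + m − 1 = 0 and m = 2. Then Γ is isomorphic to the triangular graph T(s + 1). -/
open Finset in
/-- Adjacency in the triangular graph means that the two pairs are distinct and meet. -/
theorem triangularGraph_adj_iff {n : ℕ} (A B : {A : Finset (Fin n) // A.card = 2}) :
    (triangularGraph n).Adj A B ↔ A ≠ B ∧ ¬ Disjoint A.1 B.1 := by
  rw [triangularGraph, SimpleGraph.fromRel_adj, inter_comm B.1 A.1, or_self]
  refine and_congr_right fun hne => ?_
  rw [disjoint_iff_inter_eq_empty, ← card_eq_zero]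
  have h2 : (A.1 ∩ B.1).card ≠ 2 := fun h => hne <| Subtype.ext <| by
    rw [← eq_of_subset_of_card_le inter_subset_left (by rw [h, A.2] : A.1.card ≤ (A.1 ∩ B.1).card)]
    exact eq_of_subset_of_card_le inter_subset_right (by rw [h, B.2])
  have := (card_le_card (inter_subset_left : A.1 ∩ B.1 ⊆ A.1)).trans_eq A.2
  omega

/-- A labelling of the vertices of `G` by all the pairs from an `n`-element set, such that
distinct vertices are adjacent exactly when their pairs meet, gives an isomorphism with `T(n)`. -/
theorem nonempty_iso_triangularGraph {V α : Type*} [Fintype α] {G : SimpleGraph V} {n : ℕ}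
    (hn : Fintype.card α = n) (f : V → Finset α) (hcard : ∀ u, (f u).card = 2)
    (hinj : Function.Injective f) (hsurj : ∀ A : Finset α, A.card = 2 → ∃ u, f u = A)
    (hadj : ∀ u w, G.Adj u w ↔ u ≠ w ∧ ¬ Disjoint (f u) (f w)) :
    Nonempty (G ≃g triangularGraph n) := by
  let e := Fintype.equivFinOfCardEq hn
  let g : V → {A : Finset (Fin n) // A.card = 2} :=
    fun u => ⟨(f u).map e.toEmbedding, by rw [Finset.card_map, hcard]⟩
  have hg : Function.Bijective g := by
    refine ⟨fun u w h => hinj (Finset.map_injective e.toEmbedding (congrArg Subtype.val h)),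
      fun A => ?_⟩
    obtain ⟨u, hu⟩ := hsurj (A.1.map e.symm.toEmbedding) (by rw [Finset.card_map, A.2])
    refine ⟨u, Subtype.ext ?_⟩
    ext a
    simp [g, hu]
  refine ⟨⟨Equiv.ofBijective g hg, fun {u w} => ?_⟩⟩
  rw [triangularGraph_adj_iff, hadj, Equiv.ofBijective_apply, Equiv.ofBijective_apply,
    hg.1.ne_iff, Finset.disjoint_map]

namespace SimpleGraph

open Finset
open scoped Classical

variable {V : Type*} {G : SimpleGraph V} {S : Finset V}

variable (G S) in
/-- The label of a vertex: `x ∈ S` gets the pair `{x, ∞}`, a vertex outside `S` gets its set of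
neighbours in `S`. -/
noncomputable def cliqueLabel (u : V) : Finset (Option S) :=
  {o | o.elim (u ∈ S) fun x => u = x ∨ u ∉ S ∧ G.Adj u x}

theorem none_mem_cliqueLabel {u : V} : none ∈ G.cliqueLabel S u ↔ u ∈ S := by
  simp [cliqueLabel]

theorem some_mem_cliqueLabel {u : V} {x : S} :
    some x ∈ G.cliqueLabel S u ↔ u = x ∨ u ∉ S ∧ G.Adj u x := by
  simp [cliqueLabel]

theorem cliqueLabel_of_mem {u : V} (hu : u ∈ S) :
    G.cliqueLabel S u = {none, some ⟨u, hu⟩} := by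
  ext (_ | x)
  · simp [none_mem_cliqueLabel, hu]
  · simp [some_mem_cliqueLabel, hu, Subtype.ext_iff, eq_comm]

theorem cliqueLabel_of_notMem {u : V} (hu : u ∉ S) :
    G.cliqueLabel S u = ({x : S | G.Adj u x} : Finset S).map .some := by
  ext (_ | x)
  · simp [none_mem_cliqueLabel, hu]
  · have : u ≠ x := fun h => hu (h ▸ x.2)
    simp [some_mem_cliqueLabel, hu, this]

theorem card_cliqueLabel (hreg : ∀ u ∉ S, #{x ∈ S | G.Adj u x} = 2) (u : V) :
    #(G.cliqueLabel S u) = 2 := by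
  by_cases hu : u ∈ S
  · rw [cliqueLabel_of_mem hu, card_pair (by simp)]
  · rw [cliqueLabel_of_notMem hu, card_map, ← hreg u hu, ← card_map (Function.Embedding.subtype _)]
    congr 1
    ext x
    simp [and_comm]

variable [Fintype V] {k lam : ℕ}

theorem IsClique.card_filter_adj_add (hS : G.IsClique (S : Set V))
    (hdeg : ∀ u, #{z | G.Adj u z} = k) {x : V} (hx : x ∈ S) :
    #{z ∈ Sᶜ | G.Adj x z} + #S = k + 1 := by
  rw [← hdeg x, ← card_erase_add_one hx, ← add_assoc, add_left_inj,
    ← card_union_of_disjoint]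
  · congr 1
    ext z
    have := fun hz : z ∈ S => fun hne : x ≠ z => hS hx hz hne
    have := G.ne_of_adj (a := x) (b := z)
    simp only [mem_union, mem_filter, mem_compl, mem_erase, mem_univ, true_and]
    grind
  · rw [Finset.disjoint_left]
    simp only [mem_filter, mem_compl, mem_erase]
    tauto

theorem IsClique.card_filter_adj_adj_add (hS : G.IsClique (S : Set V))
    (hlam : ∀ u w, G.Adj u w → #{z | G.Adj u z ∧ G.Adj w z} = lam)
    {x y : V} (hx : x ∈ S) (hy : y ∈ S) (hxy : x ≠ y) :
    #{z ∈ Sᶜ | G.Adj x z ∧ G.Adj y z} + #S = lam + 2 := by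
  have hy' : y ∈ S.erase x := mem_erase.2 ⟨hxy.symm, hy⟩
  rw [← hlam x y (hS hx hy hxy), ← card_erase_add_one hx, ← card_erase_add_one hy',
    ← add_assoc, ← add_assoc, add_assoc _ 1 1, add_left_inj, ← card_union_of_disjoint]
  · congr 1
    ext z
    have := fun hz : z ∈ S => fun hne : x ≠ z => hS hx hz hne
    have := fun hz : z ∈ S => fun hne : y ≠ z => hS hy hz hne
    have := G.ne_of_adj (a := x) (b := z)
    have := G.ne_of_adj (a := y) (b := z)
    simp only [mem_union, mem_filter, mem_compl, mem_erase, mem_univ, true_and]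
    grind
  · rw [Finset.disjoint_left]
    simp only [mem_filter, mem_compl, mem_erase]
    tauto

/-- Two vertices outside a `2`-regular clique with a common neighbour in the clique are
adjacent. -/
theorem IsClique.adj_of_adj_of_adj (hS : G.IsClique (S : Set V))
    (hdeg : ∀ u, #{z | G.Adj u z} = k)
    (hlam : ∀ u w, G.Adj u w → #{z | G.Adj u z ∧ G.Adj w z} = lam)
    (hreg : ∀ u ∉ S, #{x ∈ S | G.Adj u x} = 2) (hk : k + 1 = lam + #S)
    {x u w : V} (hx : x ∈ S) (hu : u ∉ S) (hw : w ∉ S)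
    (hxu : G.Adj x u) (hxw : G.Adj x w) (hne : u ≠ w) : G.Adj u w := by
  have hA := hS.card_filter_adj_add hdeg hx
  have hsplit : ({z | G.Adj x z ∧ G.Adj u z} : Finset V) =
      ({y ∈ S | G.Adj u y} : Finset V).erase x ∪ {z ∈ Sᶜ | G.Adj x z ∧ G.Adj u z} := by
    ext z
    have := fun hz : z ∈ S => fun hne : x ≠ z => hS hx hz hne
    have := G.ne_of_adj (a := x) (b := z)
    simp only [mem_union, mem_filter, mem_compl, mem_erase, mem_univ, true_and]
    grind
  have hle := card_union_le (({y ∈ S | G.Adj u y} : Finset V).erase x)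
    {z ∈ Sᶜ | G.Adj x z ∧ G.Adj u z}
  rw [← hsplit, hlam x u hxu, card_erase_of_mem (by simp [hx, hxu.symm]), hreg u hu] at hle
  have huA : u ∈ ({z ∈ Sᶜ | G.Adj x z} : Finset V) := by simp [hu, hxu]
  have hsub : ({z ∈ Sᶜ | G.Adj x z ∧ G.Adj u z} : Finset V) ⊆
      ({z ∈ Sᶜ | G.Adj x z} : Finset V).erase u := by
    intro z
    have := G.ne_of_adj (a := u) (b := z)
    simp only [mem_filter, mem_compl, mem_erase]
    grind
  have heq := eq_of_subset_of_card_le hsub (by rw [card_erase_of_mem huA]; omega)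
  have hwA : w ∈ ({z ∈ Sᶜ | G.Adj x z} : Finset V).erase u := by simp [hw, hxw, hne.symm]
  rw [← heq] at hwA
  exact (mem_filter.1 hwA).2.2

/-- Double counting: the number of vertices outside a `2`-regular clique attached to a given
pair of its vertices. -/
theorem IsClique.card_sub_one_mul_eq (hS : G.IsClique (S : Set V))
    (hdeg : ∀ u, #{z | G.Adj u z} = k)
    (hreg : ∀ u ∉ S, #{x ∈ S | G.Adj u x} = 2) {x : V} {p : ℕ} (hx : x ∈ S)
    (hp : ∀ y ∈ S, x ≠ y → #{z ∈ Sᶜ | G.Adj x z ∧ G.Adj y z} = p) :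
    (#S - 1) * p + #S = k + 1 := by
  rw [← hS.card_filter_adj_add hdeg hx, add_left_inj, ← card_erase_of_mem hx]
  have h := sum_card_bipartiteAbove_eq_sum_card_bipartiteBelow (s := S.erase x)
    (t := {z ∈ Sᶜ | G.Adj x z}) G.Adj
  have hbelow : ∀ z ∈ ({z ∈ Sᶜ | G.Adj x z} : Finset V),
      #((S.erase x).bipartiteBelow G.Adj z) = 1 := by
    intro z hz
    simp only [mem_filter, mem_compl] at hz
    have : (S.erase x).bipartiteBelow G.Adj z = ({y ∈ S | G.Adj z y} : Finset V).erase x := by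
      ext y
      simp only [mem_bipartiteBelow, mem_erase, mem_filter, G.adj_comm y z, and_assoc]
    rw [this, card_erase_of_mem (by simp [hx, hz.2.symm]), hreg z hz.1]
  have habove : ∀ y ∈ S.erase x,
      #(({z ∈ Sᶜ | G.Adj x z} : Finset V).bipartiteAbove G.Adj y) = p := by
    intro y hy
    rw [← hp y (mem_of_mem_erase hy) (ne_of_mem_erase hy).symm, bipartiteAbove, filter_filter]
  rw [sum_congr rfl hbelow, sum_congr rfl habove] at h
  simpa only [sum_const, smul_eq_mul, mul_one] using h

/-- In a non-complete graph, every pair of vertices of the clique has exactly one common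
neighbour outside the clique. -/
theorem IsClique.card_filter_adj_adj_eq_one (hS : G.IsClique (S : Set V))
    (hdeg : ∀ u, #{z | G.Adj u z} = k)
    (hlam : ∀ u w, G.Adj u w → #{z | G.Adj u z ∧ G.Adj w z} = lam)
    (hreg : ∀ u ∉ S, #{x ∈ S | G.Adj u x} = 2) (hk : k + 1 = lam + #S)
    (htop : G ≠ ⊤) (hs : 2 ≤ #S) {x y : V} (hx : x ∈ S) (hy : y ∈ S) (hxy : x ≠ y) :
    #{z ∈ Sᶜ | G.Adj x z ∧ G.Adj y z} = 1 := by
  have hs2 : #S ≠ 2 := by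
    intro h2
    have hall : ∀ u ∉ S, ∀ x ∈ S, G.Adj u x := fun u hu =>
      filter_eq_self.1 <| eq_of_subset_of_card_le (filter_subset _ _) (by rw [hreg u hu, h2])
    refine htop (eq_top_iff_forall_ne_adj.2 fun u w hne => ?_)
    by_cases hu : u ∈ S <;> by_cases hw : w ∈ S
    · exact hS hu hw hne
    · exact (hall w hw u hu).symm
    · exact hall u hu w hw
    · exact hS.adj_of_adj_of_adj hdeg hlam hreg hk hx hu hw (hall u hu x hx).symm
        (hall w hw x hx).symm hne
  have hp : ∀ y ∈ S, x ≠ y → #{z ∈ Sᶜ | G.Adj x z ∧ G.Adj y z} = lam + 2 - #S :=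
    fun y hy hxy => by have := hS.card_filter_adj_adj_add hlam hx hy hxy; omega
  have hmul := hS.card_sub_one_mul_eq hdeg hreg hx hp
  have hadd := hS.card_filter_adj_adj_add hlam hx hy hxy
  rw [← hp y hy hxy] at hmul
  generalize #{z ∈ Sᶜ | G.Adj x z ∧ G.Adj y z} = p at *
  obtain ⟨t, ht⟩ : ∃ t, #S = t + 3 := ⟨#S - 3, by omega⟩
  rw [ht] at hmul hadd hk
  have : (t + 1) * p = (t + 1) * 1 := by
    simp only [show t + 3 - 1 = t + 2 from rfl] at hmul
    linarith
  exact Nat.eq_of_mul_eq_mul_left (Nat.succ_pos t) this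

/-- Adjacent vertices outside the clique have a common neighbour in the clique. -/
theorem IsClique.exists_adj_adj (hS : G.IsClique (S : Set V))
    (hdeg : ∀ u, #{z | G.Adj u z} = k)
    (hlam : ∀ u w, G.Adj u w → #{z | G.Adj u z ∧ G.Adj w z} = lam)
    (hreg : ∀ u ∉ S, #{x ∈ S | G.Adj u x} = 2) (hk : k + 1 = lam + #S)
    (htop : G ≠ ⊤) (hs : 2 ≤ #S) {u w : V} (hu : u ∉ S) (hw : w ∉ S) (huw : G.Adj u w) :
    ∃ x ∈ S, G.Adj u x ∧ G.Adj w x := by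
  obtain ⟨x, y, hxy, hT⟩ := card_eq_two.1 (hreg u hu)
  have hx : x ∈ S ∧ G.Adj u x := by rw [← mem_filter, hT]; simp
  have hy : y ∈ S ∧ G.Adj u y := by rw [← mem_filter, hT]; simp
  set A : V → Finset V := fun x => {z ∈ Sᶜ | G.Adj x z} with hAdef
  have hAx : #(A x) + #S = k + 1 := hS.card_filter_adj_add hdeg hx.1
  have hAy : #(A y) + #S = k + 1 := hS.card_filter_adj_add hdeg hy.1
  have h1 := hS.card_filter_adj_adj_eq_one hdeg hlam hreg hk htop hs hx.1 hy.1 hxy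
  have hxyA := hS.card_filter_adj_adj_add hlam hx.1 hy.1 hxy
  have hinter : A x ∩ A y = {z ∈ Sᶜ | G.Adj x z ∧ G.Adj y z} := by
    ext z; simp only [hAdef, mem_inter, mem_filter]; tauto
  have hunion := card_union_add_card_inter (A x) (A y)
  rw [hinter, h1] at hunion
  have huA : u ∈ A x ∪ A y := by simp [hAdef, hu, hx.2.symm]
  have hsub : (A x ∪ A y).erase u ⊆ ({z ∈ Sᶜ | G.Adj u z} : Finset V) := by
    intro z hz
    simp only [hAdef, mem_erase, mem_union, mem_filter, mem_compl] at hz ⊢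
    obtain ⟨hzu, hz | hz⟩ := hz
    · exact ⟨hz.1, hS.adj_of_adj_of_adj hdeg hlam hreg hk hx.1 hu hz.1 hx.2.symm hz.2 hzu.symm⟩
    · exact ⟨hz.1, hS.adj_of_adj_of_adj hdeg hlam hreg hk hy.1 hu hz.1 hy.2.symm hz.2 hzu.symm⟩
  have hdegu : #{z ∈ Sᶜ | G.Adj u z} + 2 = k := by
    rw [← hreg u hu, ← hdeg u, ← card_union_of_disjoint]
    · congr 1
      ext z
      simp only [mem_union, mem_filter, mem_compl, mem_univ, true_and]
      tauto
    · rw [Finset.disjoint_left]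
      simp only [mem_filter, mem_compl]
      tauto
  have heq := eq_of_subset_of_card_le hsub (by rw [card_erase_of_mem huA]; omega)
  have hwA : w ∈ (A x ∪ A y).erase u := by rw [heq]; simp [hw, huw]
  simp only [hAdef, mem_erase, mem_union, mem_filter] at hwA
  obtain ⟨-, h | h⟩ := hwA
  · exact ⟨x, hx.1, hx.2, h.2.symm⟩
  · exact ⟨y, hy.1, hy.2, h.2.symm⟩

theorem IsClique.nonempty_iso_triangularGraph (hS : G.IsClique (S : Set V))
    (hdeg : ∀ u, #{z | G.Adj u z} = k)
    (hlam : ∀ u w, G.Adj u w → #{z | G.Adj u z ∧ G.Adj w z} = lam)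
    (hreg : ∀ u ∉ S, #{x ∈ S | G.Adj u x} = 2) (hk : k + 1 = lam + #S)
    (htop : G ≠ ⊤) (hs : 2 ≤ #S) :
    Nonempty (G ≃g triangularGraph (#S + 1)) := by
  refine _root_.nonempty_iso_triangularGraph (by simp) (G.cliqueLabel S) (card_cliqueLabel hreg)
    (fun u w h => ?_) (fun A hA => ?_) (fun u w => ?_)
  · have huw : u ∈ S ↔ w ∈ S := by rw [← none_mem_cliqueLabel, h, none_mem_cliqueLabel]
    by_cases hu : u ∈ S
    · have hmem : some ⟨u, hu⟩ ∈ G.cliqueLabel S w := by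
        rw [← h, some_mem_cliqueLabel]; exact Or.inl rfl
      rw [some_mem_cliqueLabel] at hmem
      exact (hmem.resolve_right fun h' => h'.1 (huw.1 hu)).symm
    · have hw : w ∉ S := mt huw.2 hu
      obtain ⟨x, y, hxy, hT⟩ := card_eq_two.1 (hreg u hu)
      have hx : x ∈ S ∧ G.Adj u x := by rw [← mem_filter, hT]; simp
      have hy : y ∈ S ∧ G.Adj u y := by rw [← mem_filter, hT]; simp
      have hadj : ∀ x ∈ S, G.Adj u x → G.Adj w x := fun x hx hux => by
        have hmem : some ⟨x, hx⟩ ∈ G.cliqueLabel S w := by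
          rw [← h, some_mem_cliqueLabel]; exact Or.inr ⟨hu, hux⟩
        rw [some_mem_cliqueLabel] at hmem
        exact (hmem.resolve_left fun h' => hw (h' ▸ hx)).2
      have h1 := hS.card_filter_adj_adj_eq_one hdeg hlam hreg hk htop hs hx.1 hy.1 hxy
      exact card_le_one.1 h1.le u (by simp [hu, hx.2.symm, hy.2.symm]) w
        (by simp [hw, (hadj x hx.1 hx.2).symm, (hadj y hy.1 hy.2).symm])
  · suffices h : ∃ u, A ⊆ G.cliqueLabel S u from h.imp fun u hu =>
      (eq_of_subset_of_card_le hu (by rw [card_cliqueLabel hreg, hA])).symm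
    obtain ⟨a, b, hab, rfl⟩ := card_eq_two.1 hA
    simp only [insert_subset_iff, singleton_subset_iff]
    rcases a with _ | x <;> rcases b with _ | y
    · exact absurd rfl hab
    · exact ⟨y, none_mem_cliqueLabel.2 y.2, some_mem_cliqueLabel.2 (Or.inl rfl)⟩
    · exact ⟨x, some_mem_cliqueLabel.2 (Or.inl rfl), none_mem_cliqueLabel.2 x.2⟩
    · have hxy : (x : V) ≠ y := fun h => hab (congrArg some (Subtype.ext h))
      have h1 := hS.card_filter_adj_adj_eq_one hdeg hlam hreg hk htop hs x.2 y.2 hxy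
      obtain ⟨u, hu⟩ := card_pos.1 (h1.symm ▸ one_pos)
      rw [mem_filter, mem_compl] at hu
      exact ⟨u, some_mem_cliqueLabel.2 (Or.inr ⟨hu.1, hu.2.1.symm⟩),
        some_mem_cliqueLabel.2 (Or.inr ⟨hu.1, hu.2.2.symm⟩)⟩
  · rw [not_disjoint_iff]
    constructor
    · intro huw
      refine ⟨huw.ne, ?_⟩
      by_cases hu : u ∈ S <;> by_cases hw : w ∈ S
      · exact ⟨none, none_mem_cliqueLabel.2 hu, none_mem_cliqueLabel.2 hw⟩
      · exact ⟨some ⟨u, hu⟩, some_mem_cliqueLabel.2 (Or.inl rfl),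
          some_mem_cliqueLabel.2 (Or.inr ⟨hw, huw.symm⟩)⟩
      · exact ⟨some ⟨w, hw⟩, some_mem_cliqueLabel.2 (Or.inr ⟨hu, huw⟩),
          some_mem_cliqueLabel.2 (Or.inl rfl)⟩
      · obtain ⟨x, hx, hux, hwx⟩ := hS.exists_adj_adj hdeg hlam hreg hk htop hs hu hw huw
        exact ⟨some ⟨x, hx⟩, some_mem_cliqueLabel.2 (Or.inr ⟨hu, hux⟩),
          some_mem_cliqueLabel.2 (Or.inr ⟨hw, hwx⟩)⟩
    · rintro ⟨hne, _ | x, hu, hw⟩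
      · exact hS (none_mem_cliqueLabel.1 hu) (none_mem_cliqueLabel.1 hw) hne
      · rw [some_mem_cliqueLabel] at hu hw
        rcases hu with rfl | ⟨hu, hux⟩ <;> rcases hw with rfl | ⟨hw, hwx⟩
        · exact absurd rfl hne
        · exact hwx.symm
        · exact hux
        · exact hS.adj_of_adj_of_adj hdeg hlam hreg hk x.2 hu hw hux.symm hwx.symm hne

end SimpleGraph

/-- If `Γ` is a Neumaier graph with parameters `(v, k, λ; m, s)`,
`k − λ − s + m − 1 = 0` and `m = 2`, then `Γ` is isomorphic to the triangular graph
`T(s + 1)`. -/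
theorem neumaier_equality_m_two {V : Type*} [Fintype V] (G : SimpleGraph V)
    (v k lam m s : ℕ) (h : IsNeumaier G v k lam m s)
    (heq : (k : ℤ) - lam - s + m - 1 = 0) (hm : m = 2) :
    Nonempty (G ≃g triangularGraph (s + 1)) := by
  obtain ⟨⟨-, -, hdeg, hlam⟩, htop, hs, S, hS, rfl, -, hreg⟩ := h
  subst hm
  refine hS.nonempty_iso_triangularGraph (k := k) (lam := lam) (fun u => ?_) (fun u w huw => ?_)
    (fun u hu => ?_) (by omega) htop hs
  · rw [← hdeg u, ← Set.ncard_coe_finset]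
    congr 1
    ext z
    simp
  · rw [← hlam u w huw, ← Set.ncard_coe_finset]
    congr 1
    ext z
    simp [SimpleGraph.mem_commonNeighbors]
  · rw [← hreg u hu, ← Set.ncard_coe_finset]
    congr 1
    ext z
    simp [and_comm]
end
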